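/- arXiv:1509.01949 — 5 statements merged into one kernel-verified Lean document; each statement's English description precedes it below -/
import Mathlib

section
/- Let A be a symmetric positive-definite n×n real matrix and let u₁, u₂ : (0,∞) × ℝⁿ → (0,∞) be smooth positive functions. With ũ := u₁^{1/2} u₂^{1/2}, the pointwise identity (∂_t ũ − div(A⁻¹∇ũ))/ũ = (1/2)[(∂_t u₁ − div(A⁻¹∇u₁))/u₁ + (∂_t u₂ − div(A⁻¹∇u₂))/u₂] + (1/4)⟨A⁻¹(∇u₁/u₁ − ∇u₂/u₂), ∇u₁/u₁ − ∇u₂/u₂⟩ holds. In particular, if u₁ and u₂ are supersolutions of ∂_t u = div(A⁻¹∇u), then so is their geometric mean ũ. -/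
noncomputable section
open Real MeasureTheory Matrix Set

/-- Partial derivative of `f` in the `i`-th coordinate direction. -/
def pd {ι : Type*} [Fintype ι] [DecidableEq ι] (f : (ι → ℝ) → ℝ) (i : ι) (x : ι → ℝ) : ℝ :=
  fderiv ℝ f x (Pi.single i 1)

/-- Spatial gradient. -/
def grad' {ι : Type*} [Fintype ι] [DecidableEq ι] (f : (ι → ℝ) → ℝ) (x : ι → ℝ) : ι → ℝ :=
  fun i => pd f i x

/-- Spatial divergence of a vector field. -/
def div' {ι : Type*} [Fintype ι] [DecidableEq ι] (V : (ι → ℝ) → ι → ℝ) (x : ι → ℝ) : ℝ :=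
  ∑ i, pd (fun y => V y i) i x

section

variable {ι : Type*} [Fintype ι] [DecidableEq ι]

theorem contDiff_pd {f : (ι → ℝ) → ℝ} (hf : ContDiff ℝ (⊤ : ℕ∞) f) (i : ι) :
    ContDiff ℝ (⊤ : ℕ∞) (pd f i) :=
  (hf.fderiv_right (m := (⊤ : ℕ∞)) (by simp)).clm_apply contDiff_const

theorem div'_mulVec_grad' (B : Matrix ι ι ℝ) {f : (ι → ℝ) → ℝ}
    (hf : ContDiff ℝ (⊤ : ℕ∞) f) (x : ι → ℝ) :
    div' (fun y => B.mulVec (grad' f y)) x = ∑ i, ∑ j, B i j * pd (pd f j) i x := by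
  have hd (j : ι) : DifferentiableAt ℝ (pd f j) x :=
    (contDiff_pd hf j).differentiable (by simp) x
  refine Finset.sum_congr rfl fun i _ => ?_
  have h : HasFDerivAt (fun y => ∑ j, B i j * pd f j y)
      (∑ j, B i j • fderiv ℝ (pd f j) x) x :=
    HasFDerivAt.fun_sum fun j _ => (hd j).hasFDerivAt.const_mul (B i j)
  change fderiv ℝ (fun y => ∑ j, B i j * pd f j y) x _ = _
  rw [h.fderiv]
  simp [pd]

theorem HasFDerivAt.sqrt_mul_sqrt {E : Type*} [NormedAddCommGroup E] [NormedSpace ℝ E]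
    {f g : E → ℝ} {f' g' : E →L[ℝ] ℝ} {x : E} (hf : HasFDerivAt f f' x)
    (hg : HasFDerivAt g g' x) (hfx : 0 < f x) (hgx : 0 < g x) :
    HasFDerivAt (fun y => f y ^ ((1 : ℝ) / 2) * g y ^ ((1 : ℝ) / 2))
      ((f x ^ ((1 : ℝ) / 2) * g x ^ ((1 : ℝ) / 2) / 2) • ((f x)⁻¹ • f' + (g x)⁻¹ • g')) x := by
  refine ((hf.rpow_const (p := 1 / 2) (Or.inl hfx.ne')).mul
    (hg.rpow_const (p := 1 / 2) (Or.inl hgx.ne'))).congr_fderiv ?_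
  ext v
  simp only [Real.rpow_sub_one hfx.ne', Real.rpow_sub_one hgx.ne', _root_.smul_apply,
    _root_.add_apply, smul_eq_mul]
  ring

theorem pd_sqrt_mul_sqrt {f g : (ι → ℝ) → ℝ} {x : ι → ℝ} (hf : DifferentiableAt ℝ f x)
    (hg : DifferentiableAt ℝ g x) (hfx : 0 < f x) (hgx : 0 < g x) (i : ι) :
    pd (fun y => f y ^ ((1 : ℝ) / 2) * g y ^ ((1 : ℝ) / 2)) i x =
      f x ^ ((1 : ℝ) / 2) * g x ^ ((1 : ℝ) / 2) / 2 * (pd f i x / f x + pd g i x / g x) := by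
  simp only [pd, (hf.hasFDerivAt.sqrt_mul_sqrt hg.hasFDerivAt hfx hgx).fderiv,
    _root_.smul_apply, _root_.add_apply, smul_eq_mul]
  ring

theorem pd_pd_sqrt_mul_sqrt {f g : (ι → ℝ) → ℝ} (hf : ContDiff ℝ (⊤ : ℕ∞) f)
    (hg : ContDiff ℝ (⊤ : ℕ∞) g) (hf0 : ∀ x, 0 < f x) (hg0 : ∀ x, 0 < g x) (i j : ι)
    (x : ι → ℝ) :
    pd (pd (fun y => f y ^ ((1 : ℝ) / 2) * g y ^ ((1 : ℝ) / 2)) j) i x =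
      f x ^ ((1 : ℝ) / 2) * g x ^ ((1 : ℝ) / 2) *
        (1 / 2 * (pd (pd f j) i x / f x + pd (pd g j) i x / g x)
          - 1 / 4 * ((pd f j x / f x - pd g j x / g x) * (pd f i x / f x - pd g i x / g x))) := by
  have hfd : Differentiable ℝ f := hf.differentiable (by simp)
  have hgd : Differentiable ℝ g := hg.differentiable (by simp)
  have hfj := ((contDiff_pd hf j).differentiable (by simp) x).hasFDerivAt
  have hgj := ((contDiff_pd hg j).differentiable (by simp) x).hasFDerivAt
  have hfi := ((hasDerivAt_inv (hf0 x).ne').comp_hasFDerivAt x (hfd x).hasFDerivAt)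
  have hgi := ((hasDerivAt_inv (hg0 x).ne').comp_hasFDerivAt x (hgd x).hasFDerivAt)
  have h := (((hfd x).hasFDerivAt.sqrt_mul_sqrt (hgd x).hasFDerivAt (hf0 x) (hg0 x)).mul_const
    ((1 : ℝ) / 2)).mul ((hfj.mul hfi).add (hgj.mul hgi))
  have heq : pd (fun y => f y ^ ((1 : ℝ) / 2) * g y ^ ((1 : ℝ) / 2)) j = _ :=
    funext fun y => pd_sqrt_mul_sqrt (hfd y) (hgd y) (hf0 y) (hg0 y) j
  have := hf0 x
  have := hg0 x
  rw [heq, pd, (h.congr_of_eventuallyEq (Filter.Eventually.of_forall fun y => by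
    simp [div_eq_mul_inv])).fderiv]
  simp only [_root_.smul_apply, _root_.add_apply, smul_eq_mul, pd, Pi.add_apply,
    Pi.mul_apply, Function.comp_apply]
  field_simp
  ring

theorem contDiff_of_contDiffOn_uncurry {E : Type*} [NormedAddCommGroup E] [NormedSpace ℝ E]
    {u : ℝ → E → ℝ}
    (hu : ContDiffOn ℝ (⊤ : ℕ∞) (Function.uncurry u) (Set.Ioi (0 : ℝ) ×ˢ Set.univ))
    {t : ℝ} (ht : 0 < t) : ContDiff ℝ (⊤ : ℕ∞) (u t) :=
  contDiffOn_univ.mp <| hu.comp (f := fun y : E => (t, y)) (by fun_prop)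
    fun _ _ => ⟨ht, Set.mem_univ _⟩

theorem differentiableAt_of_contDiffOn_uncurry {E : Type*} [NormedAddCommGroup E]
    [NormedSpace ℝ E] {u : ℝ → E → ℝ}
    (hu : ContDiffOn ℝ (⊤ : ℕ∞) (Function.uncurry u) (Set.Ioi (0 : ℝ) ×ˢ Set.univ))
    {t : ℝ} (ht : 0 < t) (x : E) : DifferentiableAt ℝ (fun s => u s x) t :=
  ((hu.comp (f := fun s : ℝ => (s, x)) (s := Set.Ioi 0) (by fun_prop)
    fun _ hs => ⟨hs, Set.mem_univ _⟩).differentiableOn (by simp)).differentiableAt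
    (Ioi_mem_nhds ht)

end

/-- The geometric-mean identity for the heat operator, and the resulting closure of
supersolutions under geometric means. -/
theorem geometric_mean_heat_identity
    {n : ℕ} (A : Matrix (Fin n) (Fin n) ℝ) (hA : A.PosDef)
    (u₁ u₂ : ℝ → (Fin n → ℝ) → ℝ)
    (h₁_smooth : ContDiffOn ℝ (⊤ : ℕ∞) (Function.uncurry u₁) (Set.Ioi (0:ℝ) ×ˢ Set.univ))
    (h₂_smooth : ContDiffOn ℝ (⊤ : ℕ∞) (Function.uncurry u₂) (Set.Ioi (0:ℝ) ×ˢ Set.univ))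
    (h₁_pos : ∀ t > (0:ℝ), ∀ x, 0 < u₁ t x)
    (h₂_pos : ∀ t > (0:ℝ), ∀ x, 0 < u₂ t x)
    (util : ℝ → (Fin n → ℝ) → ℝ)
    (hutil : util = fun t x => (u₁ t x) ^ ((1:ℝ)/2) * (u₂ t x) ^ ((1:ℝ)/2)) :
    (∀ t > (0:ℝ), ∀ x,
      (deriv (fun s => util s x) t
          - div' (fun y => A⁻¹.mulVec (grad' (util t) y)) x) / util t x
        = (1/2) * ((deriv (fun s => u₁ s x) t
              - div' (fun y => A⁻¹.mulVec (grad' (u₁ t) y)) x) / u₁ t x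
            + (deriv (fun s => u₂ s x) t
              - div' (fun y => A⁻¹.mulVec (grad' (u₂ t) y)) x) / u₂ t x)
          + (1/4) * ((A⁻¹.mulVec (fun i => grad' (u₁ t) x i / u₁ t x
                - grad' (u₂ t) x i / u₂ t x))
              ⬝ᵥ (fun i => grad' (u₁ t) x i / u₁ t x - grad' (u₂ t) x i / u₂ t x)))
    ∧ ((∀ t > (0:ℝ), ∀ x,
          deriv (fun s => u₁ s x) t ≥ div' (fun y => A⁻¹.mulVec (grad' (u₁ t) y)) x) →
       (∀ t > (0:ℝ), ∀ x,
          deriv (fun s => u₂ s x) t ≥ div' (fun y => A⁻¹.mulVec (grad' (u₂ t) y)) x) →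
       (∀ t > (0:ℝ), ∀ x,
          deriv (fun s => util s x) t ≥ div' (fun y => A⁻¹.mulVec (grad' (util t) y)) x)) := by
  have identity : ∀ t > (0:ℝ), ∀ x,
      (deriv (fun s => util s x) t
          - div' (fun y => A⁻¹.mulVec (grad' (util t) y)) x) / util t x
        = (1/2) * ((deriv (fun s => u₁ s x) t
              - div' (fun y => A⁻¹.mulVec (grad' (u₁ t) y)) x) / u₁ t x
            + (deriv (fun s => u₂ s x) t
              - div' (fun y => A⁻¹.mulVec (grad' (u₂ t) y)) x) / u₂ t x)
          + (1/4) * ((A⁻¹.mulVec (fun i => grad' (u₁ t) x i / u₁ t x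
                - grad' (u₂ t) x i / u₂ t x))
              ⬝ᵥ (fun i => grad' (u₁ t) x i / u₁ t x - grad' (u₂ t) x i / u₂ t x)) := by
    intro t ht x
    subst hutil
    have p₁ := h₁_pos t ht
    have p₂ := h₂_pos t ht
    have s₁ := contDiff_of_contDiffOn_uncurry h₁_smooth ht
    have s₂ := contDiff_of_contDiffOn_uncurry h₂_smooth ht
    have su : ContDiff ℝ (⊤ : ℕ∞)
        (fun y => u₁ t y ^ ((1 : ℝ) / 2) * u₂ t y ^ ((1 : ℝ) / 2)) :=
      (s₁.rpow_const_of_ne fun y => (p₁ y).ne').mul (s₂.rpow_const_of_ne fun y => (p₂ y).ne')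
    have d₁ := differentiableAt_of_contDiffOn_uncurry h₁_smooth ht x
    have d₂ := differentiableAt_of_contDiffOn_uncurry h₂_smooth ht x
    have hderiv : deriv (fun s => u₁ s x ^ ((1 : ℝ) / 2) * u₂ s x ^ ((1 : ℝ) / 2)) t =
        u₁ t x ^ ((1 : ℝ) / 2) * u₂ t x ^ ((1 : ℝ) / 2) / 2 *
          (deriv (fun s => u₁ s x) t / u₁ t x + deriv (fun s => u₂ s x) t / u₂ t x) := by
      simp only [← fderiv_apply_one_eq_deriv,
        (d₁.hasFDerivAt.sqrt_mul_sqrt d₂.hasFDerivAt (p₁ x) (p₂ x)).fderiv,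
        _root_.smul_apply, _root_.add_apply, smul_eq_mul]
      ring
    have hpos : 0 < u₁ t x ^ ((1 : ℝ) / 2) * u₂ t x ^ ((1 : ℝ) / 2) :=
      mul_pos (Real.rpow_pos_of_pos (p₁ x) _) (Real.rpow_pos_of_pos (p₂ x) _)
    have hdiv : div' (fun y => A⁻¹.mulVec
          (grad' (fun y => u₁ t y ^ ((1 : ℝ) / 2) * u₂ t y ^ ((1 : ℝ) / 2)) y)) x =
        u₁ t x ^ ((1 : ℝ) / 2) * u₂ t x ^ ((1 : ℝ) / 2) *
          (1 / 2 * (div' (fun y => A⁻¹.mulVec (grad' (u₁ t) y)) x / u₁ t x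
              + div' (fun y => A⁻¹.mulVec (grad' (u₂ t) y)) x / u₂ t x)
            - 1 / 4 * ((A⁻¹.mulVec (fun i => grad' (u₁ t) x i / u₁ t x
                - grad' (u₂ t) x i / u₂ t x))
              ⬝ᵥ (fun i => grad' (u₁ t) x i / u₁ t x - grad' (u₂ t) x i / u₂ t x))) := by
      rw [div'_mulVec_grad' _ su, div'_mulVec_grad' _ s₁, div'_mulVec_grad' _ s₂]
      simp only [pd_pd_sqrt_mul_sqrt s₁ s₂ p₁ p₂, Matrix.mulVec, dotProduct, grad',
        Finset.sum_mul, Finset.sum_div, Finset.mul_sum, ← Finset.sum_add_distrib,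
        ← Finset.sum_sub_distrib]
      refine Finset.sum_congr rfl fun i _ => Finset.sum_congr rfl fun j _ => ?_
      ring
    simp only [hderiv, hdiv]
    rw [div_eq_iff hpos.ne']
    ring
  refine ⟨identity, fun hs₁ hs₂ t ht x => ?_⟩
  have hpos : 0 < util t x := by
    subst hutil
    exact mul_pos (Real.rpow_pos_of_pos (h₁_pos t ht x) _)
      (Real.rpow_pos_of_pos (h₂_pos t ht x) _)
  have hquad (w : Fin n → ℝ) : 0 ≤ A⁻¹.mulVec w ⬝ᵥ w := by
    simpa [dotProduct_comm] using hA.inv.posSemidef.dotProduct_mulVec_nonneg w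
  have h₁ := div_nonneg (sub_nonneg.mpr (hs₁ t ht x)) (h₁_pos t ht x).le
  have h₂ := div_nonneg (sub_nonneg.mpr (hs₂ t ht x)) (h₂_pos t ht x).le
  have h : 0 ≤ (deriv (fun s => util s x) t
      - div' (fun y => A⁻¹.mulVec (grad' (util t) y)) x) / util t x := by
    rw [identity t ht x]
    exact add_nonneg (mul_nonneg (by norm_num) (add_nonneg h₁ h₂))
      (mul_nonneg (by norm_num) (hquad _))
  simpa using (le_div_iff₀ hpos).mp h
end
end

section
/- For each j = 1,…,m let L_j : ℝⁿ → ℝ^{n_j} be a surjective linear transformation, p_j ≥ 0 an exponent, and A_j a symmetric positive-definite linear transformation on ℝ^{n_j}, such that M := Σ_{j=1}^m p_j L_j* A_j L_j is invertible and L_j M⁻¹ L_j* = A_j⁻¹ for every j. Let u_j : (0,∞) × ℝ^{n_j} → (0,∞) be smooth with ∂_t u_j ≥ div(A_j⁻¹∇u_j) pointwise for every j. Then ũ(t,x) := ∏_{j=1}^m u_j(t, L_j x)^{p_j} satisfies ∂_t ũ ≥ div(M⁻¹∇ũ) pointwise on (0,∞) × ℝⁿ. -/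
noncomputable section
open Real MeasureTheory Matrix Set

section Calculus

variable {ι κ : Type*} [Fintype ι] [Fintype κ]

lemma hasFDerivAt_comp_mulVec {f : (κ → ℝ) → ℝ} (L : Matrix κ ι ℝ) {x : ι → ℝ}
    (hf : DifferentiableAt ℝ f (L *ᵥ x)) :
    HasFDerivAt (fun y => f (L *ᵥ y))
      ((fderiv ℝ f (L *ᵥ x)).comp (LinearMap.toContinuousLinearMap L.mulVecLin)) x :=
  hf.hasFDerivAt.comp x (LinearMap.toContinuousLinearMap L.mulVecLin).hasFDerivAt

lemma differentiableAt_mulVec {V : (ι → ℝ) → κ → ℝ} {σ : Type*} (B : Matrix σ κ ℝ) {x : ι → ℝ}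
    (hV : ∀ k, DifferentiableAt ℝ (fun y => V y k) x) (i : σ) :
    DifferentiableAt ℝ (fun y => (B *ᵥ V y) i) x := by
  simp only [mulVec, dotProduct]
  exact DifferentiableAt.fun_sum fun k _ => (hV k).const_mul _

variable [DecidableEq ι]

lemma fderiv_apply_eq_grad'_dotProduct (f : (ι → ℝ) → ℝ) (x v : ι → ℝ) :
    fderiv ℝ f x v = grad' f x ⬝ᵥ v := by
  conv_lhs => rw [pi_eq_sum_univ' v]
  rw [map_sum, dotProduct]
  refine Finset.sum_congr rfl fun i _ => ?_
  have : (fun j => if j = i then (1 : ℝ) else 0) = Pi.single i 1 := by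
    ext j; simp [Pi.single_apply]
  simp only [map_smul, smul_eq_mul, grad', pd]
  rw [← this, mul_comm]

lemma pd_sum {σ : Type*} (s : Finset σ) {f : σ → (ι → ℝ) → ℝ} {x : ι → ℝ}
    (hf : ∀ j ∈ s, DifferentiableAt ℝ (f j) x) (i : ι) :
    pd (fun y => ∑ j ∈ s, f j y) i x = ∑ j ∈ s, pd (f j) i x := by
  simp only [pd]
  rw [fderiv_fun_sum hf, _root_.sum_apply]

lemma pd_const_mul {f : (ι → ℝ) → ℝ} {x : ι → ℝ} (hf : DifferentiableAt ℝ f x) (c : ℝ) (i : ι) :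
    pd (fun y => c * f y) i x = c * pd f i x := by
  simp only [pd]
  rw [fderiv_const_mul hf]
  rfl

lemma pd_mul {f g : (ι → ℝ) → ℝ} {x : ι → ℝ} (hf : DifferentiableAt ℝ f x)
    (hg : DifferentiableAt ℝ g x) (i : ι) :
    pd (fun y => f y * g y) i x = pd f i x * g x + f x * pd g i x := by
  simp only [pd]
  rw [fderiv_fun_mul hf hg]
  simp
  ring

lemma div'_smul {f : (ι → ℝ) → ℝ} {V : (ι → ℝ) → ι → ℝ} {x : ι → ℝ}
    (hf : DifferentiableAt ℝ f x) (hV : ∀ i, DifferentiableAt ℝ (fun y => V y i) x) :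
    div' (fun y => f y • V y) x = grad' f x ⬝ᵥ V x + f x * div' V x := by
  simp only [div', Pi.smul_apply, smul_eq_mul, dotProduct, grad', Finset.mul_sum]
  rw [← Finset.sum_add_distrib]
  exact Finset.sum_congr rfl fun i _ => pd_mul hf (hV i) i

lemma div'_sum_smul {σ : Type*} (s : Finset σ) (c : σ → ℝ) {V : σ → (ι → ℝ) → ι → ℝ} {x : ι → ℝ}
    (hV : ∀ j ∈ s, ∀ i, DifferentiableAt ℝ (fun y => V j y i) x) :
    div' (fun y => ∑ j ∈ s, c j • V j y) x = ∑ j ∈ s, c j * div' (V j) x := by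
  simp only [div', Finset.sum_apply, Pi.smul_apply, smul_eq_mul, Finset.mul_sum]
  rw [Finset.sum_comm]
  refine Finset.sum_congr rfl fun i _ => ?_
  rw [pd_sum s (fun j hj => (hV j hj i).const_mul _)]
  exact Finset.sum_congr rfl fun j hj => pd_const_mul (hV j hj i) _ _

lemma div'_mulVec {V : (ι → ℝ) → κ → ℝ} (B : Matrix ι κ ℝ) {x : ι → ℝ}
    (hV : ∀ k, DifferentiableAt ℝ (fun y => V y k) x) :
    div' (fun y => B *ᵥ V y) x = ∑ i, ∑ k, B i k * pd (fun y => V y k) i x := by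
  simp only [div', mulVec, dotProduct]
  refine Finset.sum_congr rfl fun i _ => ?_
  rw [pd_sum _ fun k _ => (hV k).const_mul _]
  exact Finset.sum_congr rfl fun k _ => pd_const_mul (hV k) _ _

lemma grad'_exp {φ : (ι → ℝ) → ℝ} {x : ι → ℝ} (hφ : DifferentiableAt ℝ φ x) :
    grad' (fun y => Real.exp (φ y)) x = Real.exp (φ x) • grad' φ x := by
  ext i
  simp only [grad', pd, Pi.smul_apply]
  rw [fderiv_exp hφ]
  rfl

lemma differentiable_grad' {φ : (ι → ℝ) → ℝ} (hφ : ContDiff ℝ 2 φ) (i : ι) :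
    Differentiable ℝ (fun y => grad' φ y i) :=
  ((hφ.fderiv_right (m := 1) (by norm_num)).differentiable (by norm_num)).clm_apply
    (differentiable_const _)

/-- The anisotropic Laplacian of `exp φ` in terms of the derivatives of `φ`. -/
lemma div'_mulVec_grad'_exp {φ : (ι → ℝ) → ℝ} (hφ : ContDiff ℝ 2 φ) (B : Matrix ι ι ℝ)
    (x : ι → ℝ) :
    div' (fun y => B *ᵥ grad' (fun z => Real.exp (φ z)) y) x =
      Real.exp (φ x) * (grad' φ x ⬝ᵥ B *ᵥ grad' φ x + div' (fun y => B *ᵥ grad' φ y) x) := by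
  have hd : Differentiable ℝ φ := hφ.differentiable (by norm_num)
  have h : (fun y => B *ᵥ grad' (fun z => Real.exp (φ z)) y) =
      fun y => Real.exp (φ y) • (B *ᵥ grad' φ y) := by
    ext1 y
    rw [grad'_exp (hd y), mulVec_smul]
  rw [h, div'_smul (hd x).exp (differentiableAt_mulVec B fun k => differentiable_grad' hφ k x),
    grad'_exp (hd x), smul_dotProduct, smul_eq_mul, mul_add]

variable [DecidableEq κ]

lemma pd_comp_mulVec {f : (κ → ℝ) → ℝ} (L : Matrix κ ι ℝ) {x : ι → ℝ}
    (hf : DifferentiableAt ℝ f (L *ᵥ x)) (i : ι) :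
    pd (fun y => f (L *ᵥ y)) i x = ∑ k, L k i * pd f k (L *ᵥ x) := by
  rw [pd, (hasFDerivAt_comp_mulVec L hf).fderiv]
  simp [fderiv_apply_eq_grad'_dotProduct, dotProduct, grad', Matrix.col, mul_comm]

lemma grad'_comp_mulVec {f : (κ → ℝ) → ℝ} (L : Matrix κ ι ℝ) {x : ι → ℝ}
    (hf : DifferentiableAt ℝ f (L *ᵥ x)) :
    grad' (fun y => f (L *ᵥ y)) x = Lᵀ *ᵥ grad' f (L *ᵥ x) := by
  ext i
  exact pd_comp_mulVec L hf i

lemma div'_mulVec_comp_mulVec {V : (κ → ℝ) → κ → ℝ} (B : Matrix ι κ ℝ) (L : Matrix κ ι ℝ)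
    {x : ι → ℝ} (hV : ∀ k, DifferentiableAt ℝ (fun y => V y k) (L *ᵥ x)) :
    div' (fun y => B *ᵥ V (L *ᵥ y)) x = div' (fun y => (L * B) *ᵥ V y) (L *ᵥ x) := by
  rw [div'_mulVec (V := fun y => V (L *ᵥ y)) B
    fun k => (hasFDerivAt_comp_mulVec L (hV k)).differentiableAt, div'_mulVec _ hV]
  simp only [pd_comp_mulVec L (hV _), Matrix.mul_apply, Finset.mul_sum, Finset.sum_mul]
  rw [Finset.sum_comm]
  conv_rhs => rw [Finset.sum_comm]
  refine Finset.sum_congr rfl fun k _ => ?_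
  rw [Finset.sum_comm]
  exact Finset.sum_congr rfl fun l _ => Finset.sum_congr rfl fun i _ => by ring

end Calculus

lemma Matrix.PosDef.two_mul_dotProduct_le {κ : Type*} [Fintype κ] [DecidableEq κ]
    {A : Matrix κ κ ℝ} (hA : A.PosDef) (y g : κ → ℝ) :
    2 * (g ⬝ᵥ y) ≤ y ⬝ᵥ A *ᵥ y + g ⬝ᵥ A⁻¹ *ᵥ g := by
  have hnn := hA.posSemidef.dotProduct_mulVec_nonneg (y - A⁻¹ *ᵥ g)
  have hAA : A *ᵥ (A⁻¹ *ᵥ g) = g := by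
    rw [mulVec_mulVec, Matrix.mul_nonsing_inv _ hA.det_pos.ne'.isUnit, one_mulVec]
  have hsym : (A⁻¹ *ᵥ g) ⬝ᵥ A *ᵥ y = g ⬝ᵥ y := by
    have hT : Aᵀ = A := by simpa [conjTranspose_eq_transpose_of_trivial] using hA.isHermitian.eq
    rw [dotProduct_mulVec, ← mulVec_transpose, hT, hAA]
  simp only [star_trivial, mulVec_sub, hAA, dotProduct_sub, sub_dotProduct, hsym] at hnn
  rw [dotProduct_comm y g, dotProduct_comm (A⁻¹ *ᵥ g) g] at hnn
  linarith

/-- If `M = ∑ pⱼ Lⱼᵀ Aⱼ Lⱼ`, the quadratic form of `M⁻¹` at `∑ pⱼ Lⱼᵀ gⱼ` is bounded by the weighted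
sum of the quadratic forms of the `Aⱼ⁻¹` at `gⱼ`. -/
lemma dotProduct_inv_mulVec_sum_le {σ ι : Type*} [Fintype σ] [Fintype ι] [DecidableEq ι]
    {κ : σ → Type*} [∀ j, Fintype (κ j)] [∀ j, DecidableEq (κ j)]
    (L : ∀ j, Matrix (κ j) ι ℝ) {p : σ → ℝ} (hp : ∀ j, 0 ≤ p j)
    {A : ∀ j, Matrix (κ j) (κ j) ℝ} (hA : ∀ j, (A j).PosDef) {M : Matrix ι ι ℝ}
    (hM : M = ∑ j, p j • ((L j)ᵀ * A j * L j)) (hM_inv : IsUnit M.det) (g : ∀ j, κ j → ℝ) :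
    (∑ j, p j • (L j)ᵀ *ᵥ g j) ⬝ᵥ M⁻¹ *ᵥ (∑ j, p j • (L j)ᵀ *ᵥ g j) ≤
      ∑ j, p j * (g j ⬝ᵥ (A j)⁻¹ *ᵥ g j) := by
  set w := ∑ j, p j • (L j)ᵀ *ᵥ g j with hw
  set z := M⁻¹ *ᵥ w with hz
  have hMz : M *ᵥ z = w := by
    rw [hz, mulVec_mulVec, Matrix.mul_nonsing_inv _ hM_inv, one_mulVec]
  have h1 : w ⬝ᵥ z = ∑ j, p j * (g j ⬝ᵥ L j *ᵥ z) := by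
    rw [hw, sum_dotProduct]
    refine Finset.sum_congr rfl fun j _ => ?_
    rw [smul_dotProduct, smul_eq_mul, mulVec_transpose, ← dotProduct_mulVec]
  have h2 : w ⬝ᵥ z = ∑ j, p j * ((L j *ᵥ z) ⬝ᵥ A j *ᵥ (L j *ᵥ z)) := by
    rw [dotProduct_comm, ← hMz, hM, sum_mulVec, dotProduct_sum]
    refine Finset.sum_congr rfl fun j _ => ?_
    rw [smul_mulVec, dotProduct_smul, smul_eq_mul, ← mulVec_mulVec, ← mulVec_mulVec,
      dotProduct_mulVec, vecMul_transpose]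
  have h3 : ∑ j, p j * (2 * (g j ⬝ᵥ L j *ᵥ z)) ≤
      ∑ j, p j * ((L j *ᵥ z) ⬝ᵥ A j *ᵥ (L j *ᵥ z) + g j ⬝ᵥ (A j)⁻¹ *ᵥ g j) :=
    Finset.sum_le_sum fun j _ =>
      mul_le_mul_of_nonneg_left ((hA j).two_mul_dotProduct_le _ _) (hp j)
  simp only [mul_add, Finset.sum_add_distrib, mul_left_comm _ (2 : ℝ), ← Finset.mul_sum] at h3
  linarith

/-- Closure of supersolutions under anisotropic geometric means (the geometric
Brascamp–Lieb setting). -/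
theorem anisotropic_geometric_mean_supersolution
    {n m : ℕ} (d : Fin m → ℕ)
    (L : ∀ j, Matrix (Fin (d j)) (Fin n) ℝ)
    (hL_surj : ∀ j, Function.Surjective (fun x => (L j).mulVec x))
    (p : Fin m → ℝ) (hp : ∀ j, 0 ≤ p j)
    (A : ∀ j, Matrix (Fin (d j)) (Fin (d j)) ℝ) (hA : ∀ j, (A j).PosDef)
    (M : Matrix (Fin n) (Fin n) ℝ)
    (hM : M = ∑ j, p j • ((L j)ᵀ * A j * L j))
    (hM_inv : IsUnit M.det)
    (hBL : ∀ j, L j * M⁻¹ * (L j)ᵀ = (A j)⁻¹)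
    (u : ∀ j, ℝ → (Fin (d j) → ℝ) → ℝ)
    (hu_smooth : ∀ j, ContDiffOn ℝ (⊤ : ℕ∞) (Function.uncurry (u j)) (Set.Ioi (0:ℝ) ×ˢ Set.univ))
    (hu_pos : ∀ j, ∀ t > (0:ℝ), ∀ x, 0 < u j t x)
    (hu_super : ∀ j, ∀ t > (0:ℝ), ∀ x,
      deriv (fun s => u j s x) t ≥ div' (fun y => (A j)⁻¹.mulVec (grad' (u j t) y)) x)
    (util : ℝ → (Fin n → ℝ) → ℝ)
    (hutil : util = fun t x => ∏ j, (u j t ((L j).mulVec x)) ^ (p j)) :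
    ∀ t > (0:ℝ), ∀ x,
      deriv (fun s => util s x) t ≥ div' (fun y => M⁻¹.mulVec (grad' (util t) y)) x := by
  intro t ht x
  have hopen : IsOpen (Set.Ioi (0 : ℝ)) := isOpen_Ioi
  have hu_at (j : Fin m) (y : Fin (d j) → ℝ) :
      ContDiffAt ℝ (⊤ : ℕ∞) (Function.uncurry (u j)) (t, y) :=
    (hu_smooth j).contDiffAt ((hopen.prod isOpen_univ).mem_nhds ⟨ht, Set.mem_univ _⟩)
  have hu_space (j : Fin m) : ContDiff ℝ 2 (u j t) := by
    rw [contDiff_iff_contDiffAt]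
    intro y
    have h := ((hu_at j y).of_le (m := 2) (WithTop.coe_le_coe.2 le_top)).comp y
      (contDiffAt_const.prodMk contDiffAt_id)
    exact h
  have hu_time (j : Fin m) (y : Fin (d j) → ℝ) : DifferentiableAt ℝ (fun s => u j s y) t := by
    have h := ((hu_at j y).differentiableAt (by simp)).comp (f := fun s : ℝ => (s, y)) t
      (differentiableAt_id.prodMk (differentiableAt_const y))
    exact h
  set φ : ∀ j, (Fin (d j) → ℝ) → ℝ := fun j y => Real.log (u j t y) with hφ_def
  have hφ (j : Fin m) : ContDiff ℝ 2 (φ j) := (hu_space j).log fun y => (hu_pos j t ht y).ne'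
  have hφd (j : Fin m) : Differentiable ℝ (φ j) := (hφ j).differentiable (by norm_num)
  have hφg (j : Fin m) (k) := differentiable_grad' (hφ j) k
  have hexp (j : Fin m) : u j t = fun y => Real.exp (φ j y) := by
    ext y
    exact (Real.exp_log (hu_pos j t ht y)).symm
  have hutil_exp (s : ℝ) (hs : 0 < s) (y : Fin n → ℝ) :
      util s y = Real.exp (∑ j, p j * Real.log (u j s (L j *ᵥ y))) := by
    rw [hutil, Real.exp_sum]
    refine Finset.prod_congr rfl fun j _ => ?_
    rw [Real.rpow_def_of_pos (hu_pos j s hs _), mul_comm]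
  set Φ : (Fin n → ℝ) → ℝ := fun y => ∑ j, p j * φ j (L j *ᵥ y) with hΦ_def
  have hΦ_exp : util t = fun y => Real.exp (Φ y) := funext fun y => hutil_exp t ht y
  have hcomp (j : Fin m) : ContDiff ℝ 2 (fun y => φ j (L j *ᵥ y)) :=
    (hφ j).comp (LinearMap.toContinuousLinearMap (L j).mulVecLin).contDiff
  have hΦ : ContDiff ℝ 2 Φ := ContDiff.sum fun j _ => contDiff_const.mul (hcomp j)
  have hgradΦ (y : Fin n → ℝ) :
      grad' Φ y = ∑ j, p j • (L j)ᵀ *ᵥ grad' (φ j) (L j *ᵥ y) := by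
    have hc (j : Fin m) := ((hcomp j).differentiable (by norm_num)) y
    ext i
    simp only [Finset.sum_apply, Pi.smul_apply, smul_eq_mul]
    rw [grad', hΦ_def, pd_sum _ fun j _ => (hc j).const_mul _]
    refine Finset.sum_congr rfl fun j _ => ?_
    rw [pd_const_mul (hc j), ← grad'_comp_mulVec _ (hφd j _), grad']
  have hdivΦ : div' (fun y => M⁻¹ *ᵥ grad' Φ y) x =
      ∑ j, p j * div' (fun y => (A j)⁻¹ *ᵥ grad' (φ j) y) (L j *ᵥ x) := by
    have h : (fun y => M⁻¹ *ᵥ grad' Φ y) =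
        fun y => ∑ j, p j • ((M⁻¹ * (L j)ᵀ) *ᵥ grad' (φ j) (L j *ᵥ y)) := by
      ext1 y
      rw [hgradΦ, mulVec_sum]
      simp only [mulVec_smul, mulVec_mulVec]
    rw [h, div'_sum_smul]
    · refine Finset.sum_congr rfl fun j _ => ?_
      rw [div'_mulVec_comp_mulVec _ _ fun k => hφg j k _, ← Matrix.mul_assoc, hBL]
    · exact fun j _ => differentiableAt_mulVec _ fun k =>
        (hasFDerivAt_comp_mulVec (L j) (hφg j k _)).differentiableAt
  have hderiv : deriv (fun s => util s x) t =
      Real.exp (Φ x) * ∑ j, p j * (deriv (fun s => u j s (L j *ᵥ x)) t / u j t (L j *ᵥ x)) := by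
    have hev : (fun s => util s x) =ᶠ[nhds t]
        fun s => Real.exp (∑ j, p j * Real.log (u j s (L j *ᵥ x))) := by
      filter_upwards [hopen.mem_nhds ht] with s hs using hutil_exp s hs x
    rw [hev.deriv_eq]
    exact (HasDerivAt.fun_sum fun j _ =>
      ((hu_time j (L j *ᵥ x)).hasDerivAt.log (hu_pos j t ht _).ne').const_mul (p j)).exp.deriv
  have hsuper (j : Fin m) : grad' (φ j) (L j *ᵥ x) ⬝ᵥ (A j)⁻¹ *ᵥ grad' (φ j) (L j *ᵥ x) +
      div' (fun y => (A j)⁻¹ *ᵥ grad' (φ j) y) (L j *ᵥ x) ≤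
        deriv (fun s => u j s (L j *ᵥ x)) t / u j t (L j *ᵥ x) := by
    have h := hu_super j t ht (L j *ᵥ x)
    rw [hexp j, div'_mulVec_grad'_exp (hφ j)] at h
    rw [le_div_iff₀ (hu_pos j t ht _), hexp j, mul_comm]
    exact h
  rw [hΦ_exp, div'_mulVec_grad'_exp hΦ, hdivΦ, hgradΦ, hderiv]
  refine mul_le_mul_of_nonneg_left ?_ (Real.exp_pos _).le
  have hquad := dotProduct_inv_mulVec_sum_le L hp hA hM hM_inv
    fun j => grad' (φ j) (L j *ᵥ x)
  have hsum := Finset.sum_le_sum fun j (_ : j ∈ Finset.univ) =>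
    mul_le_mul_of_nonneg_left (hsuper j) (hp j)
  simp only [mul_add, Finset.sum_add_distrib] at hsum
  linarith
end
end

section
/- Let 1 < p < q < ∞ and s > 0 satisfy e^{2s} = (q−1)/(p−1), set ρ = e^{−s}, α₁ = 1 − 1/q, α₂ = 1/p, and B(x₁,x₂) = x₁^{α₁} x₂^{α₂}. Let L₁, L₂ : ℝ^{2n} → ℝⁿ be given in block form by L₁ = (I_n 0) and L₂ = (ρ I_n √(1−ρ²) I_n). For nonnegative F₁, F₂ ∈ L¹(dγ), where dγ is the standard gaussian probability measure on ℝⁿ, let U_j(t,x) = e^{tℒ}F_j(x) = ∫_{ℝⁿ} F_j(e^{−t}x + √(1−e^{−2t}) y) dγ(y) be the Ornstein–Uhlenbeck flow of F_j. Then the function t ↦ ∫_{ℝ^{2n}} B(U₁(t, L₁x), U₂(t, L₂x)) dγ(x), where dγ here is the standard gaussian probability measure on ℝ^{2n}, is nondecreasing for t > 0. -/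
noncomputable section
open Real MeasureTheory Matrix Set

/-- The standard gaussian probability measure on `ι → ℝ`. -/
def gaussianPi (ι : Type*) [Fintype ι] : Measure (ι → ℝ) :=
  volume.withDensity (fun y =>
    ENNReal.ofReal ((2 * π) ^ (-(Fintype.card ι : ℝ) / 2) * Real.exp (-(∑ i, y i ^ 2) / 2)))

/-- The Ornstein–Uhlenbeck flow of `F : ℝⁿ → ℝ`. -/
def ouFlow {n : ℕ} (F : (Fin n → ℝ) → ℝ) (t : ℝ) (x : Fin n → ℝ) : ℝ :=
  ∫ y, F (fun i => Real.exp (-t) * x i + Real.sqrt (1 - Real.exp (-2 * t)) * y i)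
    ∂(gaussianPi (Fin n))

open ProbabilityTheory Filter Topology
open scoped ENNReal NNReal

theorem gaussianPi_eq_pi (ι : Type*) [Fintype ι] :
    gaussianPi ι = Measure.pi (fun _ : ι => gaussianReal 0 1) := by
  refine (Measure.pi_eq fun s hs => ?_).symm
  have hdens : ∀ y : ι → ℝ, (2 * π) ^ (-(Fintype.card ι : ℝ) / 2) * Real.exp (-(∑ i, y i ^ 2) / 2)
      = ∏ i, gaussianPDFReal 0 1 (y i) := by
    intro y
    simp only [gaussianPDFReal, Finset.prod_mul_distrib, Finset.prod_const, Finset.card_univ,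
      ← Real.exp_sum]
    congr 1
    · rw [NNReal.coe_one, mul_one, Real.sqrt_eq_rpow, ← Real.rpow_neg (by positivity),
        ← Real.rpow_natCast, ← Real.rpow_mul (by positivity)]
      congr 1
      ring
    · simp [Finset.sum_div, neg_div]
  have hg : ∀ i, Integrable (gaussianPDFReal 0 1) (volume.restrict (s i)) := fun i =>
    (integrable_gaussianPDFReal 0 1).restrict
  rw [gaussianPi, withDensity_apply _ (MeasurableSet.univ_pi hs), volume_pi,
    Measure.restrict_pi_pi]
  simp_rw [hdens]
  rw [← ofReal_integral_eq_lintegral_ofReal (Integrable.fintype_prod hg)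
    (ae_of_all _ fun y => Finset.prod_nonneg fun i _ => gaussianPDFReal_nonneg 0 1 _),
    integral_fintype_prod_eq_prod (fun _ => gaussianPDFReal 0 1),
    ENNReal.ofReal_prod_of_nonneg fun i _ => integral_nonneg fun _ => gaussianPDFReal_nonneg 0 1 _]
  refine Finset.prod_congr rfl fun i _ => ?_
  rw [gaussianReal_apply_eq_integral 0 one_ne_zero]

instance isProbabilityMeasure_gaussianPi (ι : Type*) [Fintype ι] :
    IsProbabilityMeasure (gaussianPi ι) := by
  rw [gaussianPi_eq_pi]
  infer_instance

instance isGaussian_gaussianPi (ι : Type*) [Fintype ι] : IsGaussian (gaussianPi ι) := by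
  have h : gaussianPi ι
      = (stdGaussian (EuclideanSpace ℝ ι)).map (EuclideanSpace.equiv ι ℝ).toContinuousLinearMap := by
    rw [← map_pi_eq_stdGaussian, Measure.map_map (by fun_prop) (by fun_prop), gaussianPi_eq_pi]
    exact (Measure.map_id).symm
  rw [h]
  infer_instance

theorem measurePreserving_gaussianReal_add_mul {a b : ℝ} (hab : a ^ 2 + b ^ 2 = 1) :
    MeasurePreserving (fun p : ℝ × ℝ => a * p.1 + b * p.2)
      ((gaussianReal 0 1).prod (gaussianReal 0 1)) (gaussianReal 0 1) := by
  refine ⟨by fun_prop, ?_⟩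
  have h1 : (fun p : ℝ × ℝ => a * p.1 + b * p.2)
      = (fun p : ℝ × ℝ => p.1 + p.2) ∘ Prod.map (a * ·) (b * ·) := rfl
  rw [h1, ← Measure.map_map (by fun_prop) (by fun_prop),
    ← Measure.map_prod_map _ _ (by fun_prop) (by fun_prop), gaussianReal_map_const_mul,
    gaussianReal_map_const_mul]
  change _ ∗ _ = _
  rw [gaussianReal_conv_gaussianReal]
  congr 1
  · simp
  · ext; simp [hab]

/-- Rotation invariance of the standard gaussian measure. -/
theorem measurePreserving_gaussianPi_smul_add_smul {ι : Type*} [Fintype ι] {a b : ℝ}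
    (hab : a ^ 2 + b ^ 2 = 1) :
    MeasurePreserving (fun p : (ι → ℝ) × (ι → ℝ) => a • p.1 + b • p.2)
      ((gaussianPi ι).prod (gaussianPi ι)) (gaussianPi ι) := by
  simp only [gaussianPi_eq_pi]
  have h1 := (measurePreserving_arrowProdEquivProdArrow ℝ ℝ ι
    (fun _ => gaussianReal 0 1) (fun _ => gaussianReal 0 1)).symm
  have h2 := measurePreserving_pi (fun _ : ι => (gaussianReal 0 1).prod (gaussianReal 0 1))
    (fun _ => gaussianReal 0 1) (fun _ => measurePreserving_gaussianReal_add_mul hab)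
  exact h2.comp h1

theorem measurePreserving_gaussianPi_inl_add_inr {ι : Type*} [Fintype ι] {a b : ℝ}
    (hab : a ^ 2 + b ^ 2 = 1) :
    MeasurePreserving (fun x : (ι ⊕ ι) → ℝ => fun i => a * x (Sum.inl i) + b * x (Sum.inr i))
      (gaussianPi (ι ⊕ ι)) (gaussianPi ι) := by
  have h := measurePreserving_gaussianPi_smul_add_smul (ι := ι) hab
  simp only [gaussianPi_eq_pi] at h ⊢
  exact h.comp (measurePreserving_sumPiEquivProdPi (fun _ : ι ⊕ ι => gaussianReal 0 1))

theorem integral_sum_mul_sum_gaussianPi {ι : Type*} [Fintype ι] (a b : ι → ℝ) :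
    ∫ w, (∑ i, a i * w i) * (∑ i, b i * w i) ∂(gaussianPi ι) = ∑ i, a i * b i := by
  classical
  have hm : ∀ i, MemLp (fun w : ι → ℝ => w i) 2 (gaussianPi ι) := fun i =>
    (ContinuousLinearMap.proj (R := ℝ) (φ := fun _ : ι => ℝ) i).comp_memLp'
      (IsGaussian.memLp_two_id (μ := gaussianPi ι))
  have hint : ∀ i j, Integrable (fun w : ι → ℝ => w i * w j) (gaussianPi ι) := fun i j =>
    (hm i).integrable_mul (hm j)
  have hmean : ∀ i, ∫ w : ι → ℝ, w i ∂(gaussianPi ι) = 0 := by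
    intro i
    rw [gaussianPi_eq_pi, integral_eval]
    simp
  have hval : ∀ i j, ∫ w : ι → ℝ, w i * w j ∂(gaussianPi ι) = if i = j then 1 else 0 := by
    intro i j
    split_ifs with hij
    · subst hij
      have h := (measurePreserving_eval (fun _ : ι => gaussianReal 0 1) i).variance_fun_comp
        (f := fun x => x) measurable_id.aemeasurable
      rw [variance_fun_id_gaussianReal, ← gaussianPi_eq_pi,
        variance_eq_sub (hm i)] at h
      simp only at h
      rw [hmean i] at h
      simpa [pow_two] using h
    · have h := (iIndepFun_pi (μ := fun _ : ι => gaussianReal 0 1)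
        (X := fun _ => id) (fun _ => aemeasurable_id)).indepFun hij
      rw [← gaussianPi_eq_pi] at h
      have := h.integral_fun_mul_eq_mul_integral (hm i).aestronglyMeasurable
        (hm j).aestronglyMeasurable
      simpa [hmean] using this
  have hexp : ∀ w : ι → ℝ, (∑ i, a i * w i) * (∑ i, b i * w i)
      = ∑ i, ∑ j, a i * b j * (w i * w j) := by
    intro w
    rw [Finset.sum_mul_sum]
    refine Finset.sum_congr rfl fun i _ => Finset.sum_congr rfl fun j _ => by ring
  simp_rw [hexp]
  rw [integral_finsetSum _ fun i _ => integrable_finsetSum _ fun j _ => (hint i j).const_mul _]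
  refine Finset.sum_congr rfl fun i _ => ?_
  rw [integral_finsetSum _ fun j _ => (hint i j).const_mul _]
  simp [integral_const_mul, hval]

theorem one_add_rpow_le_cubic {α s : ℝ} (h0 : 0 < α) (h1 : α < 1) (hs : -1 ≤ s) :
    (1 + s) ^ α ≤ 1 + α * s - α * (1 - α) / 2 * s ^ 2 + |s| ^ 3 := by
  have hder : ∀ x : ℝ, -1 < x → HasDerivAt (fun x => (1 + x) ^ α) (α * (1 + x) ^ (α - 1)) x := by
    intro x hx
    have := ((hasDerivAt_id x).const_add 1).rpow_const (p := α) (Or.inl (by simp; linarith))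
    simpa using this
  have hcont : Continuous fun x : ℝ => (1 + x) ^ α :=
    (continuous_const.add continuous_id).rpow_const fun _ => Or.inr h0.le
  rcases le_or_gt s 0 with hs0 | hs0
  · have hanti : AntitoneOn
        (fun x : ℝ => 1 + α * x - α * (1 - α) / 2 * x ^ 2 - (1 + x) ^ α) (Set.Icc (-1) 0) := by
      refine antitoneOn_of_hasDerivWithinAt_nonpos (convex_Icc _ _)
        (f' := fun x => α - α * (1 - α) * x - α * (1 + x) ^ (α - 1)) ?_ ?_ ?_
      · exact (Continuous.sub (by fun_prop) hcont).continuousOn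
      · intro x hx
        rw [interior_Icc] at hx
        refine (HasDerivAt.congr_deriv (((((hasDerivAt_id x).const_mul α).const_add 1).sub
          (((hasDerivAt_id x).pow 2).const_mul (α * (1 - α) / 2))).sub
            (hder x hx.1)) ?_).hasDerivWithinAt
        simp
        ring
      · intro x hx
        rw [interior_Icc] at hx
        have hx1 : 0 < 1 + x := by linarith [hx.1]
        have hb := rpow_one_add_le_one_add_mul_self (s := x) (p := 1 - α)
          hx.1.le (by linarith) (by linarith)
        have hpos : 0 < (1 + x) ^ (1 - α) := Real.rpow_pos_of_pos hx1 _
        have hB : 1 - (1 - α) * x ≤ (1 + x) ^ (α - 1) := by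
          rw [← neg_sub 1 α, Real.rpow_neg hx1.le, ← one_div, le_div_iff₀ hpos]
          nlinarith [mul_le_mul_of_nonneg_left hb
            (by nlinarith [hx.2] : 0 ≤ 1 - (1 - α) * x), sq_nonneg ((1 - α) * x)]
        nlinarith
    have := hanti ⟨hs, hs0⟩ ⟨by norm_num, le_rfl⟩ hs0
    simp at this
    have h3 : 0 ≤ |s| ^ 3 := by positivity
    linarith
  · have hmono : MonotoneOn
        (fun x : ℝ => 1 + α * x - α * (1 - α) / 2 * x ^ 2 + x ^ 3 - (1 + x) ^ α) (Set.Ici 0) := by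
      refine monotoneOn_of_hasDerivWithinAt_nonneg (convex_Ici _)
        (f' := fun x => α - α * (1 - α) * x + 3 * x ^ 2 - α * (1 + x) ^ (α - 1)) ?_ ?_ ?_
      · exact (Continuous.sub (by fun_prop) hcont).continuousOn
      · intro x hx
        rw [interior_Ici] at hx
        refine (HasDerivAt.congr_deriv ((((((hasDerivAt_id x).const_mul α).const_add 1).sub
          (((hasDerivAt_id x).pow 2).const_mul (α * (1 - α) / 2))).add
            ((hasDerivAt_id x).pow 3)).sub
            (hder x (by linarith [Set.mem_Ioi.1 hx]))) ?_).hasDerivWithinAt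
        simp
        ring
      · intro x hx
        rw [interior_Ici] at hx
        have hx0 : 0 < x := hx
        have hx1 : 0 < 1 + x := by linarith
        have hb := rpow_one_add_le_one_add_mul_self (s := -(x / (1 + x))) (p := 1 - α)
          (by rw [neg_le_neg_iff, div_le_one hx1]; linarith) (by linarith) (by linarith)
        have he : 1 + -(x / (1 + x)) = (1 + x)⁻¹ := by field_simp; ring
        rw [he, Real.inv_rpow hx1.le, ← Real.rpow_neg hx1.le, neg_sub] at hb
        have hd : x - x ^ 2 ≤ x / (1 + x) := by
          rw [le_div_iff₀ hx1]; nlinarith [pow_pos hx0 3]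
        have hb' : (1 + x) ^ (α - 1) ≤ 1 - (1 - α) * x + x ^ 2 := by
          nlinarith [mul_le_mul_of_nonneg_left hd (by linarith : 0 ≤ 1 - α),
            mul_nonneg h0.le (sq_nonneg x)]
        nlinarith [mul_le_mul_of_nonneg_left hb' h0.le, sq_nonneg x,
          mul_nonneg (by linarith : 0 ≤ 1 - α) (sq_nonneg x)]
    have := hmono (Set.mem_Ici.2 le_rfl) (Set.mem_Ici.2 hs0.le) hs0.le
    simp at this
    rw [abs_of_pos hs0]
    linarith

theorem one_add_rpow_mul_one_add_rpow_le {α β s t κ m : ℝ} (hα0 : 0 < α) (hα1 : α < 1)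
    (hβ0 : 0 < β) (hβ1 : β < 1) (hs : -1 ≤ s) (ht : -1 ≤ t) (hκ0 : 0 ≤ κ) (hκ1 : κ ≤ 1)
    (hm : 1 ≤ m) (hsm : |s| ≤ κ * m) (htm : |t| ≤ κ * m) :
    (1 + s) ^ α * (1 + t) ^ β ≤ 1 + α * s + β * t
      + (-(α * (1 - α) / 2) * s ^ 2 + α * β * (s * t) - β * (1 - β) / 2 * t ^ 2)
      + 10 * κ ^ 3 * m ^ 6 := by
  have h1 := one_add_rpow_le_cubic hα0 hα1 hs
  have h2 := one_add_rpow_le_cubic hβ0 hβ1 ht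
  have h3 : (1 + s) ^ α * (1 + t) ^ β ≤ (1 + α * s - α * (1 - α) / 2 * s ^ 2 + |s| ^ 3)
      * (1 + β * t - β * (1 - β) / 2 * t ^ 2 + |t| ^ 3) :=
    mul_le_mul h1 h2 (Real.rpow_nonneg (by linarith) _)
      ((Real.rpow_nonneg (by linarith) _).trans h1)
  set a := |s| with ha
  set b := |t| with hb
  have ha0 : 0 ≤ a := abs_nonneg s
  have hb0 : 0 ≤ b := abs_nonneg t
  have hs2 : s ^ 2 = a ^ 2 := (sq_abs s).symm
  have ht2 : t ^ 2 = b ^ 2 := (sq_abs t).symm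
  have hA0 : 0 ≤ α * (1 - α) / 2 := by nlinarith
  have hA1 : α * (1 - α) / 2 ≤ 1 := by nlinarith
  have hB0 : 0 ≤ β * (1 - β) / 2 := by nlinarith
  have hB1 : β * (1 - β) / 2 ≤ 1 := by nlinarith
  have hsa : |α * s| ≤ a := by
    rw [abs_mul, abs_of_pos hα0]; nlinarith
  have htb : |β * t| ≤ b := by
    rw [abs_mul, abs_of_pos hβ0]; nlinarith
  have key : ∀ i j : ℕ, 3 ≤ i + j → i + j ≤ 6 → a ^ i * b ^ j ≤ κ ^ 3 * m ^ 6 := by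
    intro i j h3 h6
    calc a ^ i * b ^ j ≤ (κ * m) ^ i * (κ * m) ^ j := by gcongr
      _ = κ ^ (i + j) * m ^ (i + j) := by rw [← pow_add, mul_pow]
      _ ≤ κ ^ 3 * m ^ 6 := mul_le_mul (pow_le_pow_of_le_one hκ0 hκ1 h3)
          (pow_le_pow_right₀ hm h6) (by positivity) (by positivity)
  set A := α * (1 - α) / 2
  set B := β * (1 - β) / 2
  have e1 : -(α * s * (B * t ^ 2)) ≤ κ ^ 3 * m ^ 6 := by
    rw [ht2]
    have : -(α * s * (B * b ^ 2)) ≤ a * (1 * b ^ 2) := by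
      rw [← neg_mul]
      exact mul_le_mul ((neg_le_abs _).trans hsa) (by gcongr) (by positivity) ha0
    linarith [key 1 2 (by norm_num) (by norm_num)]
  have e2 : -(A * s ^ 2 * (β * t)) ≤ κ ^ 3 * m ^ 6 := by
    rw [hs2]
    have : A * a ^ 2 * -(β * t) ≤ 1 * a ^ 2 * b :=
      (mul_le_mul_of_nonneg_left ((neg_le_abs _).trans htb) (by positivity)).trans (by gcongr)
    linarith [key 2 1 (by norm_num) (by norm_num)]
  have e3 : A * s ^ 2 * (B * t ^ 2) ≤ κ ^ 3 * m ^ 6 := by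
    rw [hs2, ht2]
    have : A * a ^ 2 * (B * b ^ 2) ≤ 1 * a ^ 2 * (1 * b ^ 2) := by gcongr
    linarith [key 2 2 (by norm_num) (by norm_num)]
  have e4 : α * s * b ^ 3 ≤ κ ^ 3 * m ^ 6 := by
    have : α * s * b ^ 3 ≤ a * b ^ 3 := by gcongr; exact (le_abs_self _).trans hsa
    linarith [key 1 3 (by norm_num) (by norm_num)]
  have e5 : a ^ 3 * (β * t) ≤ κ ^ 3 * m ^ 6 := by
    have : a ^ 3 * (β * t) ≤ a ^ 3 * b := by gcongr; exact (le_abs_self _).trans htb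
    linarith [key 3 1 (by norm_num) (by norm_num)]
  have e6 := key 3 0 (by norm_num) (by norm_num)
  have e7 := key 0 3 (by norm_num) (by norm_num)
  have e8 := key 3 3 (by norm_num) (by norm_num)
  have e9 : 0 ≤ A * s ^ 2 * b ^ 3 := by positivity
  have e10 : 0 ≤ a ^ 3 * (B * t ^ 2) := by positivity
  have e11 : 0 ≤ κ ^ 3 * m ^ 6 := by positivity
  linarith

theorem one_add_rpow_mul_one_add_rpow_le_of_linear {α β s t σ τ κ m : ℝ} (hα0 : 0 < α)
    (hα1 : α < 1) (hβ0 : 0 < β) (hβ1 : β < 1) (hs : -1 ≤ s) (ht : -1 ≤ t) (hκ0 : 0 ≤ κ)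
    (hκ1 : κ ≤ 1) (hm : 1 ≤ m) (hsm : |s| ≤ κ * m) (htm : |t| ≤ κ * m)
    (hσ : |σ| ≤ κ * m) (hτ : |τ| ≤ κ * m) (hsσ : |s - σ| ≤ κ ^ 2 * m) (htτ : |t - τ| ≤ κ ^ 2 * m) :
    (1 + s) ^ α * (1 + t) ^ β ≤ 1 + α * s + β * t
      + (-(α * (1 - α) / 2) * σ ^ 2 + α * β * (σ * τ) - β * (1 - β) / 2 * τ ^ 2)
      + 16 * κ ^ 3 * m ^ 6 := by
  have h := one_add_rpow_mul_one_add_rpow_le hα0 hα1 hβ0 hβ1 hs ht hκ0 hκ1 hm hsm htm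
  have prod : ∀ x y : ℝ, |x| ≤ κ ^ 2 * m → |y| ≤ 2 * (κ * m) →
      |x * y| ≤ 2 * (κ ^ 3 * m ^ 2) := by
    intro x y hx hy
    rw [abs_mul]
    calc |x| * |y| ≤ (κ ^ 2 * m) * (2 * (κ * m)) := by gcongr
      _ = _ := by ring
  have hm2 : κ ^ 3 * m ^ 2 ≤ κ ^ 3 * m ^ 6 := by
    gcongr
    norm_num
  have d1 : |s ^ 2 - σ ^ 2| ≤ 2 * (κ ^ 3 * m ^ 2) := by
    rw [show s ^ 2 - σ ^ 2 = (s - σ) * (s + σ) by ring]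
    exact prod _ _ hsσ ((abs_add_le _ _).trans (by linarith))
  have d2 : |t ^ 2 - τ ^ 2| ≤ 2 * (κ ^ 3 * m ^ 2) := by
    rw [show t ^ 2 - τ ^ 2 = (t - τ) * (t + τ) by ring]
    exact prod _ _ htτ ((abs_add_le _ _).trans (by linarith))
  have hκm : 0 ≤ κ * m := by positivity
  have d3 : |s * t - σ * τ| ≤ 4 * (κ ^ 3 * m ^ 2) := by
    rw [show s * t - σ * τ = (s - σ) * t + (t - τ) * σ by ring]
    refine (abs_add_le _ _).trans ?_
    linarith [prod _ _ hsσ (htm.trans (by linarith)), prod _ _ htτ (hσ.trans (by linarith))]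
  have hq : 0 ≤ κ ^ 3 * m ^ 2 := by positivity
  have hαβ : 0 < α * β := mul_pos hα0 hβ0
  have hαβ1 : α * β ≤ 1 := by nlinarith
  have f1 : -(α * (1 - α) / 2 * (s ^ 2 - σ ^ 2)) ≤ 1 / 4 * (κ ^ 3 * m ^ 2) := by
    rw [abs_le] at d1
    nlinarith [sq_nonneg (α - 1 / 2), mul_nonneg hα0.le (sub_nonneg.2 hα1.le)]
  have f2 : -(β * (1 - β) / 2 * (t ^ 2 - τ ^ 2)) ≤ 1 / 4 * (κ ^ 3 * m ^ 2) := by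
    rw [abs_le] at d2
    nlinarith [sq_nonneg (β - 1 / 2), mul_nonneg hβ0.le (sub_nonneg.2 hβ1.le)]
  have f3 : α * β * (s * t - σ * τ) ≤ 4 * (κ ^ 3 * m ^ 2) := by
    rw [abs_le] at d3
    nlinarith
  linarith

section SmallStep

variable {V E : Type*} [NormedAddCommGroup V] [NormedSpace ℝ V] [MeasurableSpace V]
  [NormedAddCommGroup E] [NormedSpace ℝ E]

/-- The average of `G` over the translates `x + κ w`, where `w` has law `μ`. -/
def translateAverage (μ : Measure V) (κ : ℝ) (G : V → ℝ) (x : V) : ℝ :=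
  ∫ w, G (x + κ • w) ∂μ

/-- `G` takes values in `[m, M]` and has, uniformly, a first-order Taylor expansion whose
linear term is bounded and factors through `L`. -/
structure HasUniformTaylor (L : V →L[ℝ] E) (m M K : ℝ) (G : V → ℝ) : Prop where
  measurable : Measurable G
  lower : ∀ x, m ≤ G x
  upper : ∀ x, G x ≤ M
  exists_linear : ∃ c : V → (E →L[ℝ] ℝ), StronglyMeasurable c ∧ (∀ x, ‖c x‖ ≤ K) ∧
    ∀ x δ, |G (x + δ) - G x - c x (L δ)| ≤ K * ‖δ‖ ^ 2

variable [BorelSpace V]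

theorem integrable_comp_add_smul {μ : Measure V} [IsFiniteMeasure μ] {G : V → ℝ} {m M : ℝ}
    (hG : Measurable G) (hm : ∀ x, m ≤ G x) (hM : ∀ x, G x ≤ M) (κ : ℝ) (x : V) :
    Integrable (fun w => G (x + κ • w)) μ :=
  Integrable.of_mem_Icc m M (hG.comp (by fun_prop)).aemeasurable
    (ae_of_all _ fun _ => ⟨hm _, hM _⟩)

theorem le_translateAverage {μ : Measure V} [IsProbabilityMeasure μ] {G : V → ℝ} {m M : ℝ}
    (hG : Measurable G) (hm : ∀ x, m ≤ G x) (hM : ∀ x, G x ≤ M) (κ : ℝ) (x : V) :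
    m ≤ translateAverage μ κ G x := by
  have := integral_mono (μ := μ) (integrable_const m)
    (integrable_comp_add_smul hG hm hM κ x) fun w => hm _
  simpa [translateAverage] using this

theorem translateAverage_le {μ : Measure V} [IsProbabilityMeasure μ] {G : V → ℝ} {m M : ℝ}
    (hG : Measurable G) (hm : ∀ x, m ≤ G x) (hM : ∀ x, G x ≤ M) (κ : ℝ) (x : V) :
    translateAverage μ κ G x ≤ M := by
  have := integral_mono (μ := μ)
    (integrable_comp_add_smul hG hm hM κ x) (integrable_const M) fun w => hM _
  simpa [translateAverage] using this

variable [SecondCountableTopology V]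

theorem measurable_translateAverage {μ : Measure V} [SFinite μ] {G : V → ℝ} (hG : Measurable G)
    (κ : ℝ) : Measurable (translateAverage μ κ G) := by
  have : StronglyMeasurable fun p : V × V => G (p.1 + κ • p.2) :=
    (hG.comp (by fun_prop)).stronglyMeasurable
  exact this.integral_prod_right.measurable

theorem HasUniformTaylor.translateAverage {L : V →L[ℝ] E} {m M K : ℝ} {G : V → ℝ}
    {μ : Measure V} [IsProbabilityMeasure μ] (h : HasUniformTaylor L m M K G) (κ : ℝ) :
    HasUniformTaylor L m M K (translateAverage μ κ G) := by
  obtain ⟨c, hc, hcK, hcG⟩ := h.exists_linear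
  have hint := integrable_comp_add_smul (μ := μ) h.measurable h.lower h.upper κ
  refine ⟨measurable_translateAverage h.measurable κ,
    le_translateAverage h.measurable h.lower h.upper κ,
    translateAverage_le h.measurable h.lower h.upper κ,
    fun x => ∫ w, c (x + κ • w) ∂μ, ?_, fun x => ?_, fun x δ => ?_⟩
  · have : StronglyMeasurable fun p : V × V => c (p.1 + κ • p.2) :=
      hc.comp_measurable (by fun_prop)
    exact this.integral_prod_right
  · simpa using norm_integral_le_of_norm_le_const (μ := μ) (ae_of_all _ fun w => hcK (x + κ • w))
  · have hci : Integrable (fun w => c (x + κ • w)) μ :=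
      Integrable.of_bound (hc.comp_measurable (by fun_prop)).aestronglyMeasurable K
        (ae_of_all _ fun w => hcK _)
    rw [ContinuousLinearMap.integral_apply hci]
    have hci' : Integrable (fun w => c (x + κ • w) (L δ)) μ := hci.apply_continuousLinearMap _
    have hd : Integrable (fun w => G (x + δ + κ • w) - G (x + κ • w)) μ := (hint _).sub (hint _)
    rw [_root_.translateAverage, _root_.translateAverage, ← integral_sub (hint _) (hint _),
      ← integral_sub hd hci']
    have hb : ∀ w, ‖G (x + δ + κ • w) - G (x + κ • w) - c (x + κ • w) (L δ)‖ ≤ K * ‖δ‖ ^ 2 := by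
      intro w
      have := hcG (x + κ • w) δ
      rwa [add_right_comm] at this
    have := norm_integral_le_of_norm_le_const (ae_of_all μ hb)
    rwa [probReal_univ, mul_one] at this

theorem translateAverage_translateAverage {μ : Measure V} [IsProbabilityMeasure μ]
    (hrot : ∀ a b : ℝ, a ^ 2 + b ^ 2 = 1 →
      MeasurePreserving (fun p : V × V => a • p.1 + b • p.2) (μ.prod μ) μ)
    {G : V → ℝ} {m M : ℝ} (hG : Measurable G) (hm : ∀ x, m ≤ G x) (hM : ∀ x, G x ≤ M)
    {a b r : ℝ} (hr : 0 ≤ r) (hab : a ^ 2 + b ^ 2 = r ^ 2) (x : V) :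
    translateAverage μ a (translateAverage μ b G) x = translateAverage μ r G x := by
  rcases hr.eq_or_lt with rfl | hr
  · have ha : a = 0 := by nlinarith [sq_nonneg a, sq_nonneg b]
    have hb : b = 0 := by nlinarith [sq_nonneg a, sq_nonneg b]
    simp [ha, hb, translateAverage]
  have hint : Integrable (fun p : V × V => G (x + a • p.1 + b • p.2)) (μ.prod μ) :=
    Integrable.of_mem_Icc m M (hG.comp (by fun_prop)).aemeasurable
      (ae_of_all _ fun _ => ⟨hm _, hM _⟩)
  have hmp := hrot (a / r) (b / r) (by field_simp; exact hab)
  have h1 : translateAverage μ r G x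
      = ∫ p : V × V, G (x + r • ((a / r) • p.1 + (b / r) • p.2)) ∂(μ.prod μ) := by
    have h := integral_map (μ := μ.prod μ) hmp.measurable.aemeasurable
      (f := fun w => G (x + r • w)) (hG.comp (by fun_prop)).aestronglyMeasurable
    rwa [hmp.map_eq] at h
  rw [h1]
  simp only [smul_add, smul_smul, mul_div_cancel₀ _ hr.ne', ← add_assoc]
  rw [integral_prod _ hint]
  rfl

variable [CompleteSpace V]

theorem exists_normalized_increment {L : V →L[ℝ] E} {m M K : ℝ}
    (hm : 0 < m) {μ : Measure V} [IsGaussian μ] (hmean : ∫ w, w ∂μ = 0) :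
    ∃ A, 1 ≤ A ∧ ∀ G, HasUniformTaylor L m M K G → ∀ κ, 0 ≤ κ → κ ≤ 1 → ∀ x,
      ∃ c : E →L[ℝ] ℝ, ∀ w,
        |G (x + κ • w) / translateAverage μ κ G x - 1| ≤ κ * (A * (1 + ‖w‖ ^ 2)) ∧
        |κ * c (L w)| ≤ κ * (A * (1 + ‖w‖ ^ 2)) ∧
        |G (x + κ • w) / translateAverage μ κ G x - 1 - κ * c (L w)|
          ≤ κ ^ 2 * (A * (1 + ‖w‖ ^ 2)) := by
  set J := ∫ w, ‖w‖ ^ 2 ∂μ with hJ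
  have hJ0 : 0 ≤ J := integral_nonneg fun _ => by positivity
  have hJint : Integrable (fun w => ‖w‖ ^ 2) μ :=
    (IsGaussian.memLp_two_id (μ := μ)).integrable_norm_pow two_ne_zero
  refine ⟨1 + (|K| * ‖L‖ + |K| + |K| * J) / m, ?_, ?_⟩
  · have : 0 ≤ (|K| * ‖L‖ + |K| + |K| * J) / m := by positivity
    linarith
  intro G hG κ hκ0 hκ1 x
  obtain ⟨c, -, hcK, hcG⟩ := hG.exists_linear
  set u := translateAverage μ κ G x with hu
  have hmu : m ≤ u := le_translateAverage hG.measurable hG.lower hG.upper κ x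
  have hu0 : 0 < u := hm.trans_le hmu
  have hlin : Integrable (fun w => c x (L (κ • w))) μ := by
    have : Integrable (fun w => ((c x).comp L) w) μ :=
      ((c x).comp L).integrable_comp IsGaussian.integrable_id
    simpa using this.const_mul κ
  have hlin0 : ∫ w, c x (L (κ • w)) ∂μ = 0 := by
    have h1 : ∫ w, ((c x).comp L) w ∂μ = ((c x).comp L) (∫ w, w ∂μ) :=
      ((c x).comp L).integral_comp_comm IsGaussian.integrable_id
    rw [hmean, map_zero] at h1
    simp only [map_smul, smul_eq_mul, integral_const_mul]
    simp only [ContinuousLinearMap.comp_apply] at h1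
    rw [h1, mul_zero]
  have hint := integrable_comp_add_smul (μ := μ) hG.measurable hG.lower hG.upper κ x
  have hK : ∀ w, |G (x + κ • w) - G x - c x (L (κ • w))| ≤ |K| * κ ^ 2 * ‖w‖ ^ 2 := by
    intro w
    refine (hcG x (κ • w)).trans ?_
    rw [norm_smul, Real.norm_of_nonneg hκ0, mul_pow, ← mul_assoc]
    gcongr
    exact le_abs_self K
  have huG : |u - G x| ≤ |K| * κ ^ 2 * J := by
    have h1 : u - G x = ∫ w, (G (x + κ • w) - G x - c x (L (κ • w))) ∂μ := by
      have hd : Integrable (fun w => G (x + κ • w) - G x) μ := hint.sub (integrable_const _)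
      rw [integral_sub hd hlin, hlin0,
        integral_sub hint (integrable_const _)]
      simp [hu, translateAverage]
    rw [h1, hJ, ← integral_const_mul]
    exact norm_integral_le_of_norm_le (f := fun w => G (x + κ • w) - G x - c x (L (κ • w)))
      (hJint.const_mul (|K| * κ ^ 2)) (ae_of_all _ hK)
  refine ⟨u⁻¹ • c x, fun w => ?_⟩
  have hsq : ‖w‖ ≤ 1 + ‖w‖ ^ 2 := by nlinarith [sq_nonneg (‖w‖ - 1 / 2)]
  have hw2 : 0 ≤ ‖w‖ ^ 2 := by positivity
  have hrew : G (x + κ • w) / u - 1 = (G (x + κ • w) - u) / u := by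
    field_simp
  have hdiv : ∀ y z : ℝ, |y| ≤ z → |y / u| ≤ z / m := by
    intro y z hyz
    rw [abs_div, abs_of_pos hu0]
    exact div_le_div₀ ((abs_nonneg _).trans hyz) hyz hm hmu
  have hr : |G (x + κ • w) / u - 1 - κ * (u⁻¹ • c x) (L w)|
      ≤ κ ^ 2 * ((|K| + |K| * J) / m * (1 + ‖w‖ ^ 2)) := by
    have h1 : G (x + κ • w) / u - 1 - κ * (u⁻¹ • c x) (L w)
        = ((G (x + κ • w) - G x - c x (L (κ • w))) - (u - G x)) / u := by
      simp
      field_simp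
      ring
    rw [h1]
    refine (hdiv _ _ ((abs_sub _ _).trans (add_le_add (hK w) huG))).trans ?_
    rw [show κ ^ 2 * ((|K| + |K| * J) / m * (1 + ‖w‖ ^ 2))
      = (κ ^ 2 * ((|K| + |K| * J) * (1 + ‖w‖ ^ 2))) / m by ring]
    gcongr
    have : 0 ≤ |K| * κ ^ 2 := by positivity
    nlinarith [mul_nonneg this hJ0, mul_nonneg (mul_nonneg this hJ0) hw2]
  have hl : |κ * (u⁻¹ • c x) (L w)| ≤ κ * (|K| * ‖L‖ / m * (1 + ‖w‖ ^ 2)) := by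
    have h1 : κ * (u⁻¹ • c x) (L w) = (κ * c x (L w)) / u := by
      simp
      ring
    have h2 : |c x (L w)| ≤ |K| * (‖L‖ * ‖w‖) :=
      ((c x).le_opNorm _).trans (mul_le_mul ((hcK x).trans (le_abs_self K)) (L.le_opNorm w)
        (norm_nonneg _) (abs_nonneg _))
    rw [h1]
    refine (hdiv _ (κ * (|K| * (‖L‖ * ‖w‖))) ?_).trans ?_
    · rw [abs_mul, abs_of_nonneg hκ0]
      gcongr
    · rw [show κ * (|K| * ‖L‖ / m * (1 + ‖w‖ ^ 2)) = κ * (|K| * (‖L‖ * (1 + ‖w‖ ^ 2))) / m by ring]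
      gcongr
  have hA1 : |K| * ‖L‖ / m + (|K| + |K| * J) / m
      ≤ 1 + (|K| * ‖L‖ + |K| + |K| * J) / m := by
    rw [← add_div, ← add_assoc]; linarith
  have hnn1 : 0 ≤ |K| * ‖L‖ / m := by positivity
  have hnn2 : 0 ≤ (|K| + |K| * J) / m := by positivity
  have hw1 : 0 ≤ 1 + ‖w‖ ^ 2 := by positivity
  refine ⟨?_, hl.trans ?_, hr.trans ?_⟩
  · have h3 : κ ^ 2 * ((|K| + |K| * J) / m * (1 + ‖w‖ ^ 2))
        ≤ κ * ((|K| + |K| * J) / m * (1 + ‖w‖ ^ 2)) := by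
      gcongr
      nlinarith
    calc |G (x + κ • w) / u - 1|
        = |(G (x + κ • w) / u - 1 - κ * (u⁻¹ • c x) (L w)) + κ * (u⁻¹ • c x) (L w)| := by
          rw [sub_add_cancel]
      _ ≤ _ := abs_add_le _ _
      _ ≤ κ * ((|K| + |K| * J) / m * (1 + ‖w‖ ^ 2)) + κ * (|K| * ‖L‖ / m * (1 + ‖w‖ ^ 2)) :=
          add_le_add (hr.trans h3) hl
      _ = κ * ((|K| * ‖L‖ / m + (|K| + |K| * J) / m) * (1 + ‖w‖ ^ 2)) := by ring
      _ ≤ _ := by gcongr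
  · gcongr
    linarith
  · gcongr
    linarith

theorem HasUniformTaylor.exists_translateAverage_rpow_mul_rpow_le {L₁ L₂ : V →L[ℝ] E}
    {m M K α β : ℝ} (hm : 0 < m) (hα0 : 0 < α) (hα1 : α < 1) (hβ0 : 0 < β) (hβ1 : β < 1)
    {μ : Measure V} [IsGaussian μ] (hmean : ∫ w, w ∂μ = 0)
    (hquad : ∀ c d : E →L[ℝ] ℝ, ∫ w, (-(α * (1 - α) / 2) * c (L₁ w) ^ 2
      + α * β * (c (L₁ w) * d (L₂ w)) - β * (1 - β) / 2 * d (L₂ w) ^ 2) ∂μ ≤ 0) :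
    ∃ C, ∀ G₁ G₂, HasUniformTaylor L₁ m M K G₁ → HasUniformTaylor L₂ m M K G₂ →
      ∀ κ, 0 ≤ κ → κ ≤ 1 → ∀ x,
        _root_.translateAverage μ κ (fun y => G₁ y ^ α * G₂ y ^ β) x
          ≤ _root_.translateAverage μ κ G₁ x ^ α * _root_.translateAverage μ κ G₂ x ^ β
            + C * κ ^ 3 := by
  obtain ⟨A₁, hA₁, h₁⟩ := exists_normalized_increment (L := L₁) (M := M) (K := K) hm hmean
  obtain ⟨A₂, hA₂, h₂⟩ := exists_normalized_increment (L := L₂) (M := M) (K := K) hm hmean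
  set A := max A₁ A₂ with hA
  have hA1 : 1 ≤ A := hA₁.trans (le_max_left _ _)
  set p : V → ℝ := fun w => A * (1 + ‖w‖ ^ 2) with hp
  have hp1 : ∀ w, 1 ≤ p w := fun w => by
    have : 0 ≤ ‖w‖ ^ 2 := by positivity
    simp only [hp]
    nlinarith
  have hp₁ : ∀ w, A₁ * (1 + ‖w‖ ^ 2) ≤ p w := fun w =>
    mul_le_mul_of_nonneg_right (le_max_left _ _) (by positivity)
  have hp₂ : ∀ w, A₂ * (1 + ‖w‖ ^ 2) ≤ p w := fun w =>
    mul_le_mul_of_nonneg_right (le_max_right _ _) (by positivity)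
  have hpint : Integrable (fun w => p w ^ 6) μ := by
    have h12 : Integrable (fun w => ‖w‖ ^ 12) μ :=
      (IsGaussian.memLp_id μ 12 (by norm_num)).integrable_norm_pow (by norm_num)
    refine Integrable.mono' (((integrable_const (1 : ℝ)).add h12).const_mul (A ^ 6 * 2 ^ 5))
      (by fun_prop) (ae_of_all _ fun w => ?_)
    have hpos : 0 ≤ p w ^ 6 := by have := hp1 w; positivity
    rw [Real.norm_of_nonneg hpos]
    have := add_pow_le (zero_le_one' ℝ) (by positivity : 0 ≤ ‖w‖ ^ 2) 6
    simp only [hp, mul_pow, mul_assoc, Pi.add_apply]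
    refine mul_le_mul_of_nonneg_left (this.trans_eq ?_) (by positivity)
    ring
  refine ⟨M ^ α * M ^ β * (16 * ∫ w, p w ^ 6 ∂μ), fun G₁ G₂ hG₁ hG₂ κ hκ0 hκ1 x => ?_⟩
  obtain ⟨c, hc⟩ := h₁ G₁ hG₁ κ hκ0 hκ1 x
  obtain ⟨d, hd⟩ := h₂ G₂ hG₂ κ hκ0 hκ1 x
  set u := _root_.translateAverage μ κ G₁ x with hu
  set v := _root_.translateAverage μ κ G₂ x with hv
  have hu0 : 0 < u := hm.trans_le (le_translateAverage hG₁.measurable hG₁.lower hG₁.upper κ x)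
  have hv0 : 0 < v := hm.trans_le (le_translateAverage hG₂.measurable hG₂.lower hG₂.upper κ x)
  have huM : u ≤ M := translateAverage_le hG₁.measurable hG₁.lower hG₁.upper κ x
  have hvM : v ≤ M := translateAverage_le hG₂.measurable hG₂.lower hG₂.upper κ x
  have hi₁ := integrable_comp_add_smul (μ := μ) hG₁.measurable hG₁.lower hG₁.upper κ x
  have hi₂ := integrable_comp_add_smul (μ := μ) hG₂.measurable hG₂.lower hG₂.upper κ x
  have hs : Integrable (fun w => G₁ (x + κ • w) / u - 1) μ :=
    (hi₁.div_const _).sub (integrable_const _)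
  have ht : Integrable (fun w => G₂ (x + κ • w) / v - 1) μ :=
    (hi₂.div_const _).sub (integrable_const _)
  have hs0 : ∫ w, (G₁ (x + κ • w) / u - 1) ∂μ = 0 := by
    rw [integral_sub (hi₁.div_const _) (integrable_const _), integral_div]
    change u / u - _ = 0
    rw [div_self hu0.ne']
    simp
  have ht0 : ∫ w, (G₂ (x + κ • w) / v - 1) ∂μ = 0 := by
    rw [integral_sub (hi₂.div_const _) (integrable_const _), integral_div]
    change v / v - _ = 0
    rw [div_self hv0.ne']
    simp
  set Q : V → ℝ := fun w => -(α * (1 - α) / 2) * c (L₁ w) ^ 2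
    + α * β * (c (L₁ w) * d (L₂ w)) - β * (1 - β) / 2 * d (L₂ w) ^ 2 with hQ
  have hQint : Integrable Q μ := by
    have hcm : MemLp (fun w => c (L₁ w)) 2 μ :=
      (c.comp L₁).comp_memLp' (IsGaussian.memLp_two_id (μ := μ))
    have hdm : MemLp (fun w => d (L₂ w)) 2 μ :=
      (d.comp L₂).comp_memLp' (IsGaussian.memLp_two_id (μ := μ))
    exact ((hcm.integrable_sq.const_mul _).add ((hcm.integrable_mul hdm).const_mul _)).sub
      (hdm.integrable_sq.const_mul _)
  have hpt : ∀ w, G₁ (x + κ • w) ^ α * G₂ (x + κ • w) ^ β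
      ≤ u ^ α * v ^ β * (1 + α * (G₁ (x + κ • w) / u - 1) + β * (G₂ (x + κ • w) / v - 1)
        + κ ^ 2 * Q w + 16 * κ ^ 3 * p w ^ 6) := by
    intro w
    have hg₁ : 0 ≤ G₁ (x + κ • w) := hm.le.trans (hG₁.lower _)
    have hg₂ : 0 ≤ G₂ (x + κ • w) := hm.le.trans (hG₂.lower _)
    obtain ⟨c1, c2, c3⟩ := hc w
    obtain ⟨d1, d2, d3⟩ := hd w
    have k1 := mul_le_mul_of_nonneg_left (hp₁ w) hκ0
    have k2 := mul_le_mul_of_nonneg_left (hp₁ w) (sq_nonneg κ)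
    have k3 := mul_le_mul_of_nonneg_left (hp₂ w) hκ0
    have k4 := mul_le_mul_of_nonneg_left (hp₂ w) (sq_nonneg κ)
    have key := one_add_rpow_mul_one_add_rpow_le_of_linear hα0 hα1 hβ0 hβ1
      (by linarith [div_nonneg hg₁ hu0.le]) (by linarith [div_nonneg hg₂ hv0.le])
      hκ0 hκ1 (hp1 w) (c1.trans k1) (d1.trans k3) (c2.trans k1) (d2.trans k3)
      (c3.trans k2) (d3.trans k4)
    rw [add_sub_cancel, add_sub_cancel, Real.div_rpow hg₁ hu0.le, Real.div_rpow hg₂ hv0.le] at key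
    have huα : 0 < u ^ α := Real.rpow_pos_of_pos hu0 _
    have hvβ : 0 < v ^ β := Real.rpow_pos_of_pos hv0 _
    calc G₁ (x + κ • w) ^ α * G₂ (x + κ • w) ^ β
        = u ^ α * v ^ β * (G₁ (x + κ • w) ^ α / u ^ α * (G₂ (x + κ • w) ^ β / v ^ β)) := by
          field_simp
      _ ≤ _ := mul_le_mul_of_nonneg_left key (by positivity)
      _ = _ := by simp only [hQ]; ring
  have hR : Integrable (fun w => 1 + α * (G₁ (x + κ • w) / u - 1) + β * (G₂ (x + κ • w) / v - 1)
      + κ ^ 2 * Q w + 16 * κ ^ 3 * p w ^ 6) μ :=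
    ((((integrable_const _).add (hs.const_mul _)).add (ht.const_mul _)).add
      (hQint.const_mul _)).add (hpint.const_mul _)
  have hRint : ∫ w, (1 + α * (G₁ (x + κ • w) / u - 1) + β * (G₂ (x + κ • w) / v - 1)
      + κ ^ 2 * Q w + 16 * κ ^ 3 * p w ^ 6) ∂μ
      = 1 + κ ^ 2 * ∫ w, Q w ∂μ + 16 * κ ^ 3 * ∫ w, p w ^ 6 ∂μ := by
    have i1 : Integrable (fun w => 1 + α * (G₁ (x + κ • w) / u - 1)) μ :=
      (integrable_const _).add (hs.const_mul _)
    have i2 : Integrable (fun w => 1 + α * (G₁ (x + κ • w) / u - 1)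
        + β * (G₂ (x + κ • w) / v - 1)) μ := i1.add (ht.const_mul _)
    have i3 : Integrable (fun w => 1 + α * (G₁ (x + κ • w) / u - 1)
        + β * (G₂ (x + κ • w) / v - 1) + κ ^ 2 * Q w) μ := i2.add (hQint.const_mul _)
    rw [integral_add i3 (hpint.const_mul _), integral_add i2 (hQint.const_mul _),
      integral_add i1 (ht.const_mul _), integral_add (integrable_const _) (hs.const_mul _)]
    simp only [integral_const_mul, hs0, ht0]
    simp
  have hle := integral_mono_of_nonneg (μ := μ) (ae_of_all _ fun w =>
    mul_nonneg (Real.rpow_nonneg (hm.le.trans (hG₁.lower (x + κ • w))) α)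
      (Real.rpow_nonneg (hm.le.trans (hG₂.lower (x + κ • w))) β))
    (hR.const_mul (u ^ α * v ^ β)) (ae_of_all _ hpt)
  rw [integral_const_mul, hRint] at hle
  have hJ : 0 ≤ ∫ w, p w ^ 6 ∂μ := integral_nonneg fun w => by
    have := hp1 w
    positivity
  have huα : 0 ≤ u ^ α := Real.rpow_nonneg hu0.le _
  have hvβ : 0 ≤ v ^ β := Real.rpow_nonneg hv0.le _
  have hMα : 0 ≤ M ^ α := Real.rpow_nonneg (hu0.le.trans huM) _
  calc _root_.translateAverage μ κ (fun y => G₁ y ^ α * G₂ y ^ β) x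
      ≤ u ^ α * v ^ β * (1 + κ ^ 2 * ∫ w, Q w ∂μ + 16 * κ ^ 3 * ∫ w, p w ^ 6 ∂μ) := hle
    _ ≤ u ^ α * v ^ β * (1 + 16 * κ ^ 3 * ∫ w, p w ^ 6 ∂μ) := by
        refine mul_le_mul_of_nonneg_left ?_ (by positivity)
        have := mul_nonpos_of_nonneg_of_nonpos (sq_nonneg κ) (hquad c d)
        linarith
    _ = u ^ α * v ^ β + u ^ α * v ^ β * (16 * κ ^ 3 * ∫ w, p w ^ 6 ∂μ) := by ring
    _ ≤ u ^ α * v ^ β + M ^ α * M ^ β * (16 * κ ^ 3 * ∫ w, p w ^ 6 ∂μ) := by gcongr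
    _ = _ := by ring

theorem HasUniformTaylor.integral_rpow_mul_rpow_le {L₁ L₂ : V →L[ℝ] E}
    {m M K α β : ℝ} (hm : 0 < m) (hα0 : 0 < α) (hα1 : α < 1) (hβ0 : 0 < β) (hβ1 : β < 1)
    {μ : Measure V} [IsGaussian μ] (hmean : ∫ w, w ∂μ = 0)
    (hrot : ∀ a b : ℝ, a ^ 2 + b ^ 2 = 1 →
      MeasurePreserving (fun p : V × V => a • p.1 + b • p.2) (μ.prod μ) μ)
    (hquad : ∀ c d : E →L[ℝ] ℝ, ∫ w, (-(α * (1 - α) / 2) * c (L₁ w) ^ 2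
      + α * β * (c (L₁ w) * d (L₂ w)) - β * (1 - β) / 2 * d (L₂ w) ^ 2) ∂μ ≤ 0)
    {G₁ G₂ : V → ℝ} (hG₁ : HasUniformTaylor L₁ m M K G₁) (hG₂ : HasUniformTaylor L₂ m M K G₂) :
    ∫ w, G₁ w ^ α * G₂ w ^ β ∂μ ≤ (∫ w, G₁ w ∂μ) ^ α * (∫ w, G₂ w ∂μ) ^ β := by
  obtain ⟨C, hC⟩ := exists_translateAverage_rpow_mul_rpow_le (M := M) (K := K)
    hm hα0 hα1 hβ0 hβ1 hmean hquad
  set Φ : V → ℝ := fun y => G₁ y ^ α * G₂ y ^ β with hΦ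
  have hM0 : 0 ≤ M := hm.le.trans ((hG₁.lower 0).trans (hG₁.upper 0))
  have hΦm : Measurable Φ := (hG₁.measurable.pow_const _).mul (hG₂.measurable.pow_const _)
  have hΦ0 : ∀ x, 0 ≤ Φ x := fun x => mul_nonneg (Real.rpow_nonneg (hm.le.trans (hG₁.lower x)) α)
      (Real.rpow_nonneg (hm.le.trans (hG₂.lower x)) β)
  have hΦM : ∀ x, Φ x ≤ M ^ α * M ^ β := fun x =>
    mul_le_mul (Real.rpow_le_rpow (hm.le.trans (hG₁.lower x)) (hG₁.upper x) hα0.le)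
      (Real.rpow_le_rpow (hm.le.trans (hG₂.lower x)) (hG₂.upper x) hβ0.le)
      (Real.rpow_nonneg (hm.le.trans (hG₂.lower x)) β) (Real.rpow_nonneg hM0 _)
  have hiter : ∀ κ : ℝ, 0 ≤ κ → κ ≤ 1 → ∀ (k : ℕ) (r : ℝ), 0 ≤ r → r ^ 2 = k * κ ^ 2 → ∀ x,
      _root_.translateAverage μ r Φ x ≤ _root_.translateAverage μ r G₁ x ^ α
        * _root_.translateAverage μ r G₂ x ^ β + k * (C * κ ^ 3) := by
    intro κ hκ0 hκ1 k
    induction k with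
    | zero =>
      intro r _ hr x
      have : r = 0 := by simpa using hr
      simp [this, _root_.translateAverage, hΦ]
    | succ k ih =>
      intro r hr0 hr x
      set r' := Real.sqrt k * κ with hr'
      have hr'0 : 0 ≤ r' := by positivity
      have hr'2 : r' ^ 2 = k * κ ^ 2 := by
        rw [hr', mul_pow, Real.sq_sqrt (Nat.cast_nonneg k)]
      have hsum : κ ^ 2 + r' ^ 2 = r ^ 2 := by
        rw [hr'2, hr]
        push_cast
        ring
      have hT₁ := hG₁.translateAverage (μ := μ) r'
      have hT₂ := hG₂.translateAverage (μ := μ) r'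
      set T₁ := _root_.translateAverage μ r' G₁ with hT₁'
      set T₂ := _root_.translateAverage μ r' G₂ with hT₂'
      have hTm : Measurable fun y => T₁ y ^ α * T₂ y ^ β :=
        (hT₁.measurable.pow_const _).mul (hT₂.measurable.pow_const _)
      have hTint : Integrable (fun w => T₁ (x + κ • w) ^ α * T₂ (x + κ • w) ^ β) μ :=
        integrable_comp_add_smul (G := fun y => T₁ y ^ α * T₂ y ^ β) (m := 0) (M := M ^ α * M ^ β)
          hTm
          (fun y => mul_nonneg (Real.rpow_nonneg (hm.le.trans (hT₁.lower y)) α)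
            (Real.rpow_nonneg (hm.le.trans (hT₂.lower y)) β))
          (fun y => mul_le_mul
            (Real.rpow_le_rpow (hm.le.trans (hT₁.lower y)) (hT₁.upper y) hα0.le)
            (Real.rpow_le_rpow (hm.le.trans (hT₂.lower y)) (hT₂.upper y) hβ0.le)
            (Real.rpow_nonneg (hm.le.trans (hT₂.lower y)) β) (Real.rpow_nonneg hM0 _)) κ x
      have hstep := hC T₁ T₂ hT₁ hT₂ κ hκ0 hκ1 x
      rw [hT₁', hT₂', translateAverage_translateAverage hrot hG₁.measurable hG₁.lower hG₁.upper
        hr0 hsum, translateAverage_translateAverage hrot hG₂.measurable hG₂.lower hG₂.upper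
        hr0 hsum, ← hT₁', ← hT₂'] at hstep
      rw [← translateAverage_translateAverage hrot hΦm hΦ0 hΦM hr0 hsum]
      have hmono : _root_.translateAverage μ κ (_root_.translateAverage μ r' Φ) x
          ≤ _root_.translateAverage μ κ (fun y => T₁ y ^ α * T₂ y ^ β) x + k * (C * κ ^ 3) := by
        have h1 : ∫ w, (T₁ (x + κ • w) ^ α * T₂ (x + κ • w) ^ β + k * (C * κ ^ 3)) ∂μ
            = _root_.translateAverage μ κ (fun y => T₁ y ^ α * T₂ y ^ β) x
              + k * (C * κ ^ 3) := by
          rw [integral_add hTint (integrable_const _)]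
          simp [_root_.translateAverage]
        rw [← h1]
        refine integral_mono (integrable_comp_add_smul
          (measurable_translateAverage hΦm r') (le_translateAverage hΦm hΦ0 hΦM r')
          (translateAverage_le hΦm hΦ0 hΦM r') κ x) (hTint.add (integrable_const _)) fun w => ?_
        exact ih r' hr'0 hr'2 (x + κ • w)
      refine hmono.trans ((add_le_add_left hstep _).trans_eq ?_)
      push_cast
      ring
  have hfin : ∀ n : ℕ, ∫ w, G₁ w ^ α * G₂ w ^ β ∂μ
      ≤ (∫ w, G₁ w ∂μ) ^ α * (∫ w, G₂ w ∂μ) ^ β + C * (1 / ((n : ℝ) + 1)) := by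
    intro n
    have hn : (0 : ℝ) < (n : ℝ) + 1 := by positivity
    have h := hiter (1 / ((n : ℝ) + 1)) (by positivity)
      (by rw [div_le_one hn]; linarith [(Nat.cast_nonneg n : (0 : ℝ) ≤ n)])
      ((n + 1) ^ 2) 1 zero_le_one (by push_cast; field_simp) 0
    simp only [_root_.translateAverage, one_smul, zero_add] at h
    refine h.trans_eq ?_
    push_cast
    field_simp
  have hlim : Tendsto (fun n : ℕ => (∫ w, G₁ w ∂μ) ^ α * (∫ w, G₂ w ∂μ) ^ β
      + C * (1 / ((n : ℝ) + 1))) atTop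
      (𝓝 ((∫ w, G₁ w ∂μ) ^ α * (∫ w, G₂ w ∂μ) ^ β + C * 0)) :=
    (tendsto_one_div_add_atTop_nhds_zero_nat.const_mul C).const_add _
  rw [mul_zero, add_zero] at hlim
  exact ge_of_tendsto' hlim hfin

end SmallStep

section GaussianMixture

variable {ι : Type*} [Fintype ι]

/-- The linear map `(u, v) ↦ a u + b v`. -/
def sumMix (ι : Type*) [Fintype ι] (a b : ℝ) : ((ι ⊕ ι) → ℝ) →L[ℝ] (ι → ℝ) :=
  ContinuousLinearMap.pi fun i => a • ContinuousLinearMap.proj (Sum.inl i)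
    + b • ContinuousLinearMap.proj (Sum.inr i)

theorem sumMix_apply (a b : ℝ) (w : (ι ⊕ ι) → ℝ) (i : ι) :
    sumMix ι a b w i = a * w (Sum.inl i) + b * w (Sum.inr i) := rfl

theorem measurePreserving_sumMix {a b : ℝ} (hab : a ^ 2 + b ^ 2 = 1) :
    MeasurePreserving (sumMix ι a b) (gaussianPi (ι ⊕ ι)) (gaussianPi ι) :=
  measurePreserving_gaussianPi_inl_add_inr hab

theorem integral_id_gaussianPi : ∫ w, w ∂(gaussianPi ι) = 0 := by
  have hmp := measurePreserving_gaussianPi_smul_add_smul (ι := ι) (a := -1) (b := 0) (by norm_num)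
  have h := integral_map (μ := (gaussianPi ι).prod (gaussianPi ι)) hmp.measurable.aemeasurable
    (f := fun w => w) aestronglyMeasurable_id
  rw [hmp.map_eq] at h
  simp only [neg_smul, one_smul, zero_smul, add_zero] at h
  rw [integral_neg, integral_fun_fst (fun w : ι → ℝ => w)] at h
  simp only [probReal_univ, one_smul] at h
  exact self_eq_neg.mp h

theorem clm_sumMix_apply (c : (ι → ℝ) →L[ℝ] ℝ) (a b : ℝ) (w : (ι ⊕ ι) → ℝ) [DecidableEq ι] :
    c (sumMix ι a b w) = ∑ j, Sum.elim (fun i => a * c (Pi.single i 1))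
      (fun i => b * c (Pi.single i 1)) j * w j := by
  rw [← ContinuousLinearMap.coe_coe, LinearMap.pi_apply_eq_sum_univ]
  rw [Fintype.sum_sum_type, ← Finset.sum_add_distrib]
  refine Finset.sum_congr rfl fun i _ => ?_
  have : (fun j => if i = j then (1 : ℝ) else 0) = Pi.single i 1 := by
    ext j
    simp [Pi.single_apply, eq_comm]
  simp only [this, sumMix_apply, smul_eq_mul, Sum.elim_inl, Sum.elim_inr,
    ContinuousLinearMap.coe_coe]
  ring

theorem integral_clm_sumMix_mul (c d : (ι → ℝ) →L[ℝ] ℝ) (a b a' b' : ℝ) [DecidableEq ι] :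
    ∫ w, c (sumMix ι a b w) * d (sumMix ι a' b' w) ∂(gaussianPi (ι ⊕ ι))
      = (a * a' + b * b') * ∑ i, c (Pi.single i 1) * d (Pi.single i 1) := by
  simp only [clm_sumMix_apply]
  rw [integral_sum_mul_sum_gaussianPi, Fintype.sum_sum_type, ← Finset.sum_add_distrib,
    Finset.mul_sum]
  refine Finset.sum_congr rfl fun i _ => ?_
  simp only [Sum.elim_inl, Sum.elim_inr]
  ring

theorem integral_quadratic_sumMix_nonpos {α β ρ σ : ℝ} (hα0 : 0 < α) (hα1 : α < 1)
    (hρσ : ρ ^ 2 + σ ^ 2 = 1)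
    (hcrit : ρ ^ 2 * (α * β) = (1 - α) * (1 - β)) (c d : (ι → ℝ) →L[ℝ] ℝ) :
    ∫ w, (-(α * (1 - α) / 2) * c (sumMix ι 1 0 w) ^ 2
      + α * β * (c (sumMix ι 1 0 w) * d (sumMix ι ρ σ w))
      - β * (1 - β) / 2 * d (sumMix ι ρ σ w) ^ 2) ∂(gaussianPi (ι ⊕ ι)) ≤ 0 := by
  classical
  have hcm : MemLp (fun w => c (sumMix ι 1 0 w)) 2 (gaussianPi (ι ⊕ ι)) :=
    (c.comp (sumMix ι 1 0)).comp_memLp' IsGaussian.memLp_two_id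
  have hdm : MemLp (fun w => d (sumMix ι ρ σ w)) 2 (gaussianPi (ι ⊕ ι)) :=
    (d.comp (sumMix ι ρ σ)).comp_memLp' IsGaussian.memLp_two_id
  have i1 := hcm.integrable_sq.const_mul (-(α * (1 - α) / 2))
  have i2 : Integrable (fun w => α * β * (c (sumMix ι 1 0 w) * d (sumMix ι ρ σ w)))
      (gaussianPi (ι ⊕ ι)) := (hcm.integrable_mul hdm).const_mul (α * β)
  have i3 := hdm.integrable_sq.const_mul (β * (1 - β) / 2)
  have i12 : Integrable (fun w => -(α * (1 - α) / 2) * c (sumMix ι 1 0 w) ^ 2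
      + α * β * (c (sumMix ι 1 0 w) * d (sumMix ι ρ σ w))) (gaussianPi (ι ⊕ ι)) := i1.add i2
  rw [integral_sub i12 i3, integral_add i1 i2]
  simp only [integral_const_mul, sq (c _), sq (d _), integral_clm_sumMix_mul, Finset.mul_sum]
  rw [← Finset.sum_add_distrib, ← Finset.sum_sub_distrib]
  refine Finset.sum_nonpos fun i _ => ?_
  set x := c (Pi.single i 1)
  set y := d (Pi.single i 1)
  have hpos : 0 < α * (1 - α) := mul_pos hα0 (by linarith)
  have key : 0 ≤ (α * (1 - α) * x - α * β * ρ * y) ^ 2 := sq_nonneg _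
  have hrr : ρ * ρ + σ * σ = 1 := by linarith
  have e : α * (1 - α) * (-(α * (1 - α) / 2) * ((1 * 1 + 0 * 0) * (x * x))
      + α * β * ((1 * ρ + 0 * σ) * (x * y)) - β * (1 - β) / 2 * ((ρ * ρ + σ * σ) * (y * y)))
      = -((α * (1 - α) * x - α * β * ρ * y) ^ 2) / 2 := by
    rw [hrr]
    linear_combination (α * β * y ^ 2 / 2) * hcrit
  by_contra! hcon
  have := mul_pos hpos hcon
  rw [e] at this
  linarith

theorem integral_rpow_mul_rpow_sumMix_le {α β ρ σ m M K : ℝ} (hm : 0 < m)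
    (hα0 : 0 < α) (hα1 : α < 1) (hβ0 : 0 < β) (hβ1 : β < 1) (hρσ : ρ ^ 2 + σ ^ 2 = 1)
    (hcrit : ρ ^ 2 * (α * β) = (1 - α) * (1 - β)) {G₁ G₂ : ((ι ⊕ ι) → ℝ) → ℝ}
    (hG₁ : HasUniformTaylor (sumMix ι 1 0) m M K G₁)
    (hG₂ : HasUniformTaylor (sumMix ι ρ σ) m M K G₂) :
    ∫ w, G₁ w ^ α * G₂ w ^ β ∂(gaussianPi (ι ⊕ ι))
      ≤ (∫ w, G₁ w ∂(gaussianPi (ι ⊕ ι))) ^ α * (∫ w, G₂ w ∂(gaussianPi (ι ⊕ ι))) ^ β :=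
  HasUniformTaylor.integral_rpow_mul_rpow_le hm hα0 hα1 hβ0 hβ1 integral_id_gaussianPi
    (fun _ _ hab => measurePreserving_gaussianPi_smul_add_smul hab)
    (integral_quadratic_sumMix_nonpos hα0 hα1 hρσ hcrit) hG₁ hG₂

end GaussianMixture

section Approximation

variable {V E : Type*} [NormedAddCommGroup V] [NormedSpace ℝ V] [MeasurableSpace V]
  [NormedAddCommGroup E] [NormedSpace ℝ E]

theorem HasUniformTaylor.mono {L : V →L[ℝ] E} {m M K m' M' K' : ℝ} {G : V → ℝ}
    (h : HasUniformTaylor L m M K G) (hm : m' ≤ m) (hM : M ≤ M') (hK : K ≤ K') :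
    HasUniformTaylor L m' M' K' G := by
  obtain ⟨c, hc, hcK, hcG⟩ := h.exists_linear
  exact ⟨h.measurable, fun x => hm.trans (h.lower x), fun x => (h.upper x).trans hM,
    c, hc, fun x => (hcK x).trans hK, fun x δ => (hcG x δ).trans (by gcongr)⟩

theorem exists_hasUniformTaylor_comp_add_const [OpensMeasurableSpace V]
    [SecondCountableTopology V] (L : V →L[ℝ] E) {h : E → ℝ}
    (hh : ContDiff ℝ 2 h) (hs : HasCompactSupport h) (h0 : ∀ x, 0 ≤ h x) (m : ℝ) :
    ∃ M K, HasUniformTaylor L m M K fun w => h (L w) + m := by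
  obtain ⟨C, hC⟩ := hs.exists_bound_of_continuous hh.continuous
  obtain ⟨K₁, hK₁⟩ := (hs.fderiv ℝ).exists_bound_of_continuous (hh.continuous_fderiv (by norm_num))
  obtain ⟨K₂, hK₂⟩ := ContDiff.lipschitzWith_of_hasCompactSupport (hs.fderiv ℝ)
    (hh.fderiv_right (m := 1) (by norm_num)) one_ne_zero
  have hcont : Continuous fun w => h (L w) + m := (hh.continuous.comp L.continuous).add_const m
  refine ⟨C + m, max K₁ (K₂ * ‖L‖ ^ 2), hcont.measurable, fun x => by linarith [h0 (L x)],
    fun x => by linarith [le_abs_self (h (L x)), hC (L x), Real.norm_eq_abs (h (L x))],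
    fun w => fderiv ℝ h (L w), ?_, fun x => (hK₁ _).trans (le_max_left _ _), fun x δ => ?_⟩
  · exact ((hh.continuous_fderiv (by norm_num)).comp L.continuous).stronglyMeasurable
  · have key := Convex.norm_image_sub_le_of_norm_hasFDerivWithin_le' (𝕜 := ℝ) (f := h)
      (f' := fderiv ℝ h) (φ := fderiv ℝ h (L x)) (C := K₂ * ‖L δ‖)
      (s := Metric.closedBall (L x) ‖L δ‖) (x := L x) (y := L x + L δ)
      (fun z _ => ((hh.differentiable (by norm_num)) z).hasFDerivAt.hasFDerivWithinAt)
      (fun z hz => (hK₂.norm_sub_le z (L x)).trans (by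
        rw [mem_closedBall_iff_norm] at hz
        gcongr)) (convex_closedBall _ _) (Metric.mem_closedBall_self (norm_nonneg _))
      (by simp)
    rw [add_sub_cancel_left, Real.norm_eq_abs] at key
    rw [map_add, add_sub_add_right_eq_sub]
    refine key.trans ?_
    calc (K₂ : ℝ) * ‖L δ‖ * ‖L δ‖ = K₂ * ‖L δ‖ ^ 2 := by ring
      _ ≤ K₂ * (‖L‖ * ‖δ‖) ^ 2 := by
        gcongr
        exact L.le_opNorm δ
      _ = K₂ * ‖L‖ ^ 2 * ‖δ‖ ^ 2 := by ring
      _ ≤ _ := by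
        gcongr
        exact le_max_right _ _

theorem abs_sqrt_sq_add_sq_sub_le {a b ε : ℝ} (hb : 0 ≤ b) (hε : 0 ≤ ε) :
    |√(a ^ 2 + ε ^ 2) - b| ≤ |a - b| + ε := by
  have h1 : |a| ≤ √(a ^ 2 + ε ^ 2) := Real.abs_le_sqrt (by nlinarith [sq_nonneg ε])
  have h2 : √(a ^ 2 + ε ^ 2) ≤ |a| + ε := by
    rw [Real.sqrt_le_left (by positivity)]
    nlinarith [sq_abs a, abs_nonneg a, mul_nonneg (abs_nonneg a) hε]
  have h3 := abs_abs_sub_abs_le_abs_sub a b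
  rw [abs_of_nonneg hb] at h3
  rw [abs_le] at h3 ⊢
  constructor <;> linarith

theorem exists_contDiff_approximation [MeasurableSpace E] [BorelSpace E] [FiniteDimensional ℝ E]
    {μ : Measure E} [IsProbabilityMeasure μ] {g : E → ℝ} (hg0 : ∀ x, 0 ≤ g x)
    (hg : Integrable g μ) :
    ∃ (h : ℕ → E → ℝ) (ε : ℕ → ℝ), (∀ k, 0 < ε k ∧ ContDiff ℝ 2 (h k) ∧ HasCompactSupport (h k) ∧
        ∀ x, 0 ≤ h k x) ∧
      (∀ᵐ x ∂μ, Tendsto (fun k => h k x + ε k) atTop (𝓝 (g x))) ∧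
      Tendsto (fun k => ∫ x, (h k x + ε k) ∂μ) atTop (𝓝 (∫ x, g x ∂μ)) := by
  obtain ⟨ε, hε, hεlim⟩ : ∃ ε : ℕ → ℝ, (∀ k, 0 < ε k) ∧ Tendsto ε atTop (𝓝 0) :=
    ⟨fun k => 1 / ((k : ℝ) + 1), fun k => by positivity, tendsto_one_div_add_atTop_nhds_zero_nat⟩
  choose φ hφs hφ hφg using fun k : ℕ => (memLp_one_iff_integrable.mpr hg).exist_eLpNorm_sub_le
    ENNReal.one_ne_top le_rfl (hε k)
  set f : ℕ → E → ℝ := fun k x => √(φ k x ^ 2 + ε k ^ 2) with hf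
  have hfsmooth : ∀ k, ContDiff ℝ 2 (f k) := fun k =>
    (((contDiff_infty.1 (hφ k) 2).pow 2).add contDiff_const).sqrt fun x => by
      have := hε k
      positivity
  have hfm : ∀ k, AEStronglyMeasurable (f k) μ := fun k =>
    (hfsmooth k).continuous.aestronglyMeasurable
  have hL1 : Tendsto (fun k => eLpNorm (f k - g) 1 μ) atTop (𝓝 0) := by
    have hb : ∀ k, eLpNorm (f k - g) 1 μ ≤ ENNReal.ofReal (ε k) + ENNReal.ofReal (ε k) := by
      intro k
      calc eLpNorm (f k - g) 1 μ
          ≤ eLpNorm ((fun x => ‖(g - φ k) x‖) + fun _ => ε k) 1 μ := by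
            refine eLpNorm_mono_real fun x => ?_
            simp only [Pi.sub_apply, Pi.add_apply, Real.norm_eq_abs]
            rw [abs_sub_comm (g x)]
            exact abs_sqrt_sq_add_sq_sub_le (hg0 x) (hε k).le
        _ ≤ eLpNorm (fun x => ‖(g - φ k) x‖) 1 μ + eLpNorm (fun _ : E => ε k) 1 μ :=
            eLpNorm_add_le (hg.aestronglyMeasurable.sub
              (hφ k).continuous.aestronglyMeasurable).norm aestronglyMeasurable_const le_rfl
        _ ≤ _ := by
            gcongr
            · rw [eLpNorm_norm]
              exact hφg k
            · rw [eLpNorm_const _ one_ne_zero (IsProbabilityMeasure.ne_zero μ)]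
              simp [Real.enorm_eq_ofReal (hε k).le]
    have hlim : Tendsto (fun k => ENNReal.ofReal (ε k) + ENNReal.ofReal (ε k)) atTop (𝓝 0) := by
      have h1 : Tendsto (fun k => ENNReal.ofReal (ε k)) atTop (𝓝 0) := by
        have := ENNReal.tendsto_ofReal hεlim
        simpa using this
      simpa using h1.add h1
    exact tendsto_of_tendsto_of_tendsto_of_le_of_le tendsto_const_nhds hlim
      (fun _ => zero_le) hb
  obtain ⟨ns, hns, hae⟩ := (tendstoInMeasure_of_tendsto_eLpNorm one_ne_zero hfm
    hg.aestronglyMeasurable hL1).exists_seq_tendsto_ae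
  have hsub' : ∀ k x, f k x - ε k + ε k = f k x := fun k x => by ring
  have hfi : ∀ k, Integrable (f k) μ := by
    intro k
    obtain ⟨C, hC⟩ := (hφs k).exists_bound_of_continuous (hφ k).continuous
    refine Integrable.of_bound (hfm k) (C + ε k) (ae_of_all _ fun x => ?_)
    have := abs_sqrt_sq_add_sq_sub_le (a := φ k x) le_rfl (hε k).le
    rw [sub_zero, sub_zero] at this
    exact this.trans (add_le_add_left (hC x) _)
  refine ⟨fun k x => f (ns k) x - ε (ns k), fun k => ε (ns k), fun k => ⟨hε _,
    (hfsmooth _).sub contDiff_const, ?_, fun x => ?_⟩, ?_, ?_⟩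
  · exact (hφs (ns k)).comp_left (g := fun y => √(y ^ 2 + ε (ns k) ^ 2) - ε (ns k)) (by
      simp [Real.sqrt_sq (hε (ns k)).le])
  · rw [sub_nonneg]
    exact Real.le_sqrt_of_sq_le (by nlinarith [sq_nonneg (φ (ns k) x)])
  · simpa only [hsub'] using hae
  · simp only [hsub']
    exact (tendsto_integral_of_L1' g hg.aestronglyMeasurable (Eventually.of_forall hfi) hL1).comp
      hns.tendsto_atTop

end Approximation

section Hypercontractivity

variable {ι : Type*} [Fintype ι]

theorem integral_rpow_mul_rpow_add_const_sumMix_le {α β ρ σ : ℝ}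
    (hα0 : 0 < α) (hα1 : α < 1) (hβ0 : 0 < β) (hβ1 : β < 1) (hρσ : ρ ^ 2 + σ ^ 2 = 1)
    (hcrit : ρ ^ 2 * (α * β) = (1 - α) * (1 - β)) {h₁ h₂ : (ι → ℝ) → ℝ} {ε₁ ε₂ : ℝ}
    (hh₁ : ContDiff ℝ 2 h₁) (hs₁ : HasCompactSupport h₁) (h0₁ : ∀ x, 0 ≤ h₁ x) (hε₁ : 0 < ε₁)
    (hh₂ : ContDiff ℝ 2 h₂) (hs₂ : HasCompactSupport h₂) (h0₂ : ∀ x, 0 ≤ h₂ x) (hε₂ : 0 < ε₂) :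
    Integrable (fun w => (h₁ (sumMix ι 1 0 w) + ε₁) ^ α * (h₂ (sumMix ι ρ σ w) + ε₂) ^ β)
        (gaussianPi (ι ⊕ ι)) ∧
      ∫ w, (h₁ (sumMix ι 1 0 w) + ε₁) ^ α * (h₂ (sumMix ι ρ σ w) + ε₂) ^ β ∂(gaussianPi (ι ⊕ ι))
        ≤ (∫ x, (h₁ x + ε₁) ∂(gaussianPi ι)) ^ α * (∫ x, (h₂ x + ε₂) ∂(gaussianPi ι)) ^ β := by
  obtain ⟨M₁, K₁, H₁⟩ := exists_hasUniformTaylor_comp_add_const (sumMix ι 1 0) hh₁ hs₁ h0₁ ε₁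
  obtain ⟨M₂, K₂, H₂⟩ := exists_hasUniformTaylor_comp_add_const (sumMix ι ρ σ) hh₂ hs₂ h0₂ ε₂
  have key := integral_rpow_mul_rpow_sumMix_le (lt_min hε₁ hε₂) hα0 hα1 hβ0 hβ1 hρσ hcrit
    (H₁.mono (min_le_left _ _) (le_max_left M₁ M₂) (le_max_left K₁ K₂))
    (H₂.mono (min_le_right _ _) (le_max_right M₁ M₂) (le_max_right K₁ K₂))
  have e₁ := integral_map (μ := gaussianPi (ι ⊕ ι)) (sumMix ι 1 0).measurable.aemeasurable
    (f := fun x => h₁ x + ε₁) (hh₁.continuous.add_const _).aestronglyMeasurable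
  have e₂ := integral_map (μ := gaussianPi (ι ⊕ ι)) (sumMix ι ρ σ).measurable.aemeasurable
    (f := fun x => h₂ x + ε₂) (hh₂.continuous.add_const _).aestronglyMeasurable
  rw [(measurePreserving_sumMix (by norm_num)).map_eq] at e₁
  rw [(measurePreserving_sumMix hρσ).map_eq] at e₂
  rw [e₁, e₂]
  refine ⟨Integrable.of_mem_Icc 0 (M₁ ^ α * M₂ ^ β)
    ((H₁.measurable.pow_const _).mul (H₂.measurable.pow_const _)).aemeasurable
    (ae_of_all _ fun w => ?_), key⟩
  have p₁ : 0 ≤ h₁ (sumMix ι 1 0 w) + ε₁ := hε₁.le.trans (H₁.lower w)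
  have p₂ : 0 ≤ h₂ (sumMix ι ρ σ w) + ε₂ := hε₂.le.trans (H₂.lower w)
  exact ⟨by positivity, mul_le_mul (Real.rpow_le_rpow p₁ (H₁.upper w) hα0.le)
    (Real.rpow_le_rpow p₂ (H₂.upper w) hβ0.le) (by positivity)
    (Real.rpow_nonneg (p₁.trans (H₁.upper w)) _)⟩

/-- The two-function form of gaussian hypercontractivity. -/
theorem lintegral_rpow_mul_rpow_sumMix_le {α β ρ σ : ℝ}
    (hα0 : 0 < α) (hα1 : α < 1) (hβ0 : 0 < β) (hβ1 : β < 1) (hρσ : ρ ^ 2 + σ ^ 2 = 1)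
    (hcrit : ρ ^ 2 * (α * β) = (1 - α) * (1 - β)) {G₁ G₂ : (ι → ℝ) → ℝ≥0∞}
    (hG₁ : Measurable G₁) (hG₂ : Measurable G₂)
    (hi₁ : ∫⁻ x, G₁ x ∂(gaussianPi ι) ≠ ∞) (hi₂ : ∫⁻ x, G₂ x ∂(gaussianPi ι) ≠ ∞) :
    ∫⁻ w, G₁ (sumMix ι 1 0 w) ^ α * G₂ (sumMix ι ρ σ w) ^ β ∂(gaussianPi (ι ⊕ ι))
      ≤ (∫⁻ x, G₁ x ∂(gaussianPi ι)) ^ α * (∫⁻ x, G₂ x ∂(gaussianPi ι)) ^ β := by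
  have mp₁ := measurePreserving_sumMix (ι := ι) (a := 1) (b := 0) (by norm_num)
  have mp₂ := measurePreserving_sumMix (ι := ι) hρσ
  have g₁i := integrable_toReal_of_lintegral_ne_top hG₁.aemeasurable hi₁
  have g₂i := integrable_toReal_of_lintegral_ne_top hG₂.aemeasurable hi₂
  obtain ⟨h₁, ε₁, hh₁, ha₁, hl₁⟩ := exists_contDiff_approximation
    (fun _ => ENNReal.toReal_nonneg) g₁i
  obtain ⟨h₂, ε₂, hh₂, ha₂, hl₂⟩ := exists_contDiff_approximation
    (fun _ => ENNReal.toReal_nonneg) g₂i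
  have key := fun k => integral_rpow_mul_rpow_add_const_sumMix_le hα0 hα1 hβ0 hβ1 hρσ hcrit
    (hh₁ k).2.1 (hh₁ k).2.2.1 (hh₁ k).2.2.2 (hh₁ k).1
    (hh₂ k).2.1 (hh₂ k).2.2.1 (hh₂ k).2.2.2 (hh₂ k).1
  set f : ℕ → ((ι ⊕ ι) → ℝ) → ℝ := fun k w =>
    (h₁ k (sumMix ι 1 0 w) + ε₁ k) ^ α * (h₂ k (sumMix ι ρ σ w) + ε₂ k) ^ β with hf
  have hf0 : ∀ k w, 0 ≤ f k w := fun k w =>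
    mul_nonneg (Real.rpow_nonneg (add_nonneg ((hh₁ k).2.2.2 _) (hh₁ k).1.le) _)
      (Real.rpow_nonneg (add_nonneg ((hh₂ k).2.2.2 _) (hh₂ k).1.le) _)
  have hfm : ∀ k, Measurable (f k) := fun k =>
    ((((hh₁ k).2.1.continuous.measurable.comp (sumMix ι 1 0).measurable).add_const _).pow_const
      _).mul
    ((((hh₂ k).2.1.continuous.measurable.comp (sumMix ι ρ σ).measurable).add_const _).pow_const _)
  have hlim : Tendsto (fun k => ENNReal.ofReal
      ((∫ x, (h₁ k x + ε₁ k) ∂(gaussianPi ι)) ^ α * (∫ x, (h₂ k x + ε₂ k) ∂(gaussianPi ι)) ^ β))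
      atTop (𝓝 (ENNReal.ofReal ((∫ x, (G₁ x).toReal ∂(gaussianPi ι)) ^ α
        * (∫ x, (G₂ x).toReal ∂(gaussianPi ι)) ^ β))) :=
    ENNReal.tendsto_ofReal
      ((hl₁.rpow_const (Or.inr hα0.le)).mul (hl₂.rpow_const (Or.inr hβ0.le)))
  have hae : ∀ᵐ w ∂(gaussianPi (ι ⊕ ι)), G₁ (sumMix ι 1 0 w) ^ α * G₂ (sumMix ι ρ σ w) ^ β
      = liminf (fun k => ENNReal.ofReal (f k w)) atTop := by
    filter_upwards [mp₁.quasiMeasurePreserving.ae ha₁, mp₂.quasiMeasurePreserving.ae ha₂,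
      mp₁.quasiMeasurePreserving.ae (ae_lt_top hG₁ hi₁),
      mp₂.quasiMeasurePreserving.ae (ae_lt_top hG₂ hi₂)] with w c₁ c₂ t₁ t₂
    have := ENNReal.tendsto_ofReal
      ((c₁.rpow_const (Or.inr hα0.le)).mul (c₂.rpow_const (Or.inr hβ0.le)))
    rw [this.liminf_eq, ENNReal.ofReal_mul (by positivity),
      ← ENNReal.ofReal_rpow_of_nonneg ENNReal.toReal_nonneg hα0.le,
      ← ENNReal.ofReal_rpow_of_nonneg ENNReal.toReal_nonneg hβ0.le,
      ENNReal.ofReal_toReal t₁.ne, ENNReal.ofReal_toReal t₂.ne]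
  have hnn₁ : 0 ≤ ∫ x, (G₁ x).toReal ∂(gaussianPi ι) :=
    integral_nonneg fun _ => ENNReal.toReal_nonneg
  have hnn₂ : 0 ≤ ∫ x, (G₂ x).toReal ∂(gaussianPi ι) :=
    integral_nonneg fun _ => ENNReal.toReal_nonneg
  calc ∫⁻ w, G₁ (sumMix ι 1 0 w) ^ α * G₂ (sumMix ι ρ σ w) ^ β ∂(gaussianPi (ι ⊕ ι))
      = ∫⁻ w, liminf (fun k => ENNReal.ofReal (f k w)) atTop ∂(gaussianPi (ι ⊕ ι)) :=
        lintegral_congr_ae hae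
    _ ≤ liminf (fun k => ∫⁻ w, ENNReal.ofReal (f k w) ∂(gaussianPi (ι ⊕ ι))) atTop :=
        lintegral_liminf_le fun k => (hfm k).ennreal_ofReal
    _ ≤ liminf (fun k => ENNReal.ofReal ((∫ x, (h₁ k x + ε₁ k) ∂(gaussianPi ι)) ^ α
          * (∫ x, (h₂ k x + ε₂ k) ∂(gaussianPi ι)) ^ β)) atTop := by
        refine liminf_le_liminf (Eventually.of_forall fun k => ?_)
        rw [← ofReal_integral_eq_lintegral_ofReal (key k).1 (ae_of_all _ (hf0 k))]
        exact ENNReal.ofReal_le_ofReal (key k).2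
    _ = _ := by
        rw [hlim.liminf_eq, ENNReal.ofReal_mul (Real.rpow_nonneg hnn₁ _),
          ← ENNReal.ofReal_rpow_of_nonneg hnn₁ hα0.le, ← ENNReal.ofReal_rpow_of_nonneg hnn₂ hβ0.le,
          integral_toReal hG₁.aemeasurable (ae_lt_top hG₁ hi₁),
          integral_toReal hG₂.aemeasurable (ae_lt_top hG₂ hi₂),
          ENNReal.ofReal_toReal hi₁, ENNReal.ofReal_toReal hi₂]

end Hypercontractivity

section Mehler

variable {ι : Type*} [Fintype ι]

/-- The Mehler average `x ↦ ∫ G(a x + b y) dγ(y)` of a nonnegative function. -/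
def mehlerAverage (a b : ℝ) (G : (ι → ℝ) → ℝ≥0∞) (x : ι → ℝ) : ℝ≥0∞ :=
  ∫⁻ y, G (a • x + b • y) ∂(gaussianPi ι)

theorem measurable_mehlerAverage (a b : ℝ) {G : (ι → ℝ) → ℝ≥0∞} (hG : Measurable G) :
    Measurable (mehlerAverage a b G) := by
  have : Measurable fun p : (ι → ℝ) × (ι → ℝ) => G (a • p.1 + b • p.2) := hG.comp (by fun_prop)
  exact this.lintegral_prod_right'

theorem lintegral_lintegral_smul_add_smul {a b r : ℝ} (hr : 0 < r) (hab : a ^ 2 + b ^ 2 = r ^ 2)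
    {G : (ι → ℝ) → ℝ≥0∞} (hG : Measurable G) :
    ∫⁻ x, ∫⁻ y, G (a • x + b • y) ∂(gaussianPi ι) ∂(gaussianPi ι)
      = ∫⁻ y, G (r • y) ∂(gaussianPi ι) := by
  have hmp := measurePreserving_gaussianPi_smul_add_smul (ι := ι) (a := a / r) (b := b / r)
    (by field_simp; exact hab)
  have h : Measurable fun y => G (r • y) := hG.comp (by fun_prop)
  rw [← hmp.lintegral_comp h,
    lintegral_prod (fun p : (ι → ℝ) × (ι → ℝ) => G (r • ((a / r) • p.1 + (b / r) • p.2)))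
      (h.comp hmp.measurable).aemeasurable]
  simp only [smul_add, smul_smul, mul_div_cancel₀ _ hr.ne']

theorem lintegral_mehlerAverage {a b : ℝ} (hab : a ^ 2 + b ^ 2 = 1)
    {G : (ι → ℝ) → ℝ≥0∞} (hG : Measurable G) :
    ∫⁻ x, mehlerAverage a b G x ∂(gaussianPi ι) = ∫⁻ x, G x ∂(gaussianPi ι) := by
  have h := lintegral_lintegral_smul_add_smul (ι := ι) one_pos
    (hab.trans (one_pow 2).symm) hG
  simpa only [mehlerAverage, one_smul] using h

theorem mehlerAverage_mehlerAverage {a b a' b' r : ℝ} (hr : 0 < r)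
    (h : (a * b') ^ 2 + b ^ 2 = r ^ 2) {G : (ι → ℝ) → ℝ≥0∞} (hG : Measurable G) (x : ι → ℝ) :
    mehlerAverage a' b' (mehlerAverage a b G) x = mehlerAverage (a * a') r G x := by
  have := lintegral_lintegral_smul_add_smul (ι := ι) hr h
    (G := fun z => G ((a * a') • x + z)) (hG.comp (by fun_prop))
  simp only [mehlerAverage, smul_add, smul_smul, add_assoc]
  exact this

theorem lintegral_rpow_mul_rpow_le_mehlerAverage {α β ρ σ a b : ℝ}
    (hα0 : 0 < α) (hα1 : α < 1) (hβ0 : 0 < β) (hβ1 : β < 1) (hρσ : ρ ^ 2 + σ ^ 2 = 1)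
    (hcrit : ρ ^ 2 * (α * β) = (1 - α) * (1 - β)) (hab : a ^ 2 + b ^ 2 = 1)
    {G₁ G₂ : (ι → ℝ) → ℝ≥0∞} (hG₁ : Measurable G₁) (hG₂ : Measurable G₂)
    (hi₁ : ∫⁻ x, G₁ x ∂(gaussianPi ι) ≠ ∞) (hi₂ : ∫⁻ x, G₂ x ∂(gaussianPi ι) ≠ ∞) :
    ∫⁻ w, G₁ (sumMix ι 1 0 w) ^ α * G₂ (sumMix ι ρ σ w) ^ β ∂(gaussianPi (ι ⊕ ι))
      ≤ ∫⁻ w, mehlerAverage a b G₁ (sumMix ι 1 0 w) ^ α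
          * mehlerAverage a b G₂ (sumMix ι ρ σ w) ^ β ∂(gaussianPi (ι ⊕ ι)) := by
  have mp₁ := measurePreserving_sumMix (ι := ι) (a := 1) (b := 0) (by norm_num)
  have mp₂ := measurePreserving_sumMix (ι := ι) hρσ
  have hm : Measurable fun w => G₁ (sumMix ι 1 0 w) ^ α * G₂ (sumMix ι ρ σ w) ^ β :=
    ((hG₁.comp (sumMix ι 1 0).measurable).pow_const _).mul
      ((hG₂.comp (sumMix ι ρ σ).measurable).pow_const _)
  rw [← lintegral_mehlerAverage hab hm]
  have t₁ := ae_lt_top (measurable_mehlerAverage a b hG₁) (by rwa [lintegral_mehlerAverage hab hG₁])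
  have t₂ := ae_lt_top (measurable_mehlerAverage a b hG₂) (by rwa [lintegral_mehlerAverage hab hG₂])
  refine lintegral_mono_ae ?_
  filter_upwards [mp₁.quasiMeasurePreserving.ae t₁, mp₂.quasiMeasurePreserving.ae t₂] with w h₁ h₂
  have := lintegral_rpow_mul_rpow_sumMix_le hα0 hα1 hβ0 hβ1 hρσ hcrit
    (G₁ := fun y => G₁ (a • sumMix ι 1 0 w + b • y))
    (G₂ := fun y => G₂ (a • sumMix ι ρ σ w + b • y))
    (hG₁.comp (by fun_prop)) (hG₂.comp (by fun_prop)) h₁.ne h₂.ne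
  simpa only [mehlerAverage, map_add, map_smul] using this

theorem quasiMeasurePreserving_smul_add_smul_gaussianPi (a : ℝ) {b : ℝ} (hb : b ≠ 0)
    (x : ι → ℝ) :
    Measure.QuasiMeasurePreserving (fun y => a • x + b • y) (gaussianPi ι) (gaussianPi ι) := by
  have h₁ : gaussianPi ι ≪ volume := withDensity_absolutelyContinuous _ _
  have h₂ : volume ≪ gaussianPi ι := by
    refine withDensity_absolutelyContinuous' (Measurable.aemeasurable (by fun_prop)) (ae_of_all _ fun y => ?_)
    rw [ne_eq, ENNReal.ofReal_eq_zero, not_le]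
    positivity
  have hs : Measure.QuasiMeasurePreserving (fun y : ι → ℝ => b • y) := by
    refine ⟨by fun_prop, ?_⟩
    rw [Measure.map_addHaar_smul _ hb]
    exact Measure.smul_absolutelyContinuous
  have ht : Measure.QuasiMeasurePreserving (fun y : ι → ℝ => a • x + y) :=
    quasiMeasurePreserving_add_left _ _
  exact ((ht.comp hs).mono_left h₁).mono_right h₂

theorem integral_smul_add_smul_eq_toReal_mehlerAverage {F : (ι → ℝ) → ℝ} {G : (ι → ℝ) → ℝ≥0∞}
    (hG : Measurable G)
    (hFG : ∀ᵐ x ∂(gaussianPi ι), F x = (G x).toReal) (hGtop : ∀ x, G x ≠ ∞)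
    (a : ℝ) {b : ℝ} (hb : b ≠ 0) (x : ι → ℝ) :
    ∫ y, F (a • x + b • y) ∂(gaussianPi ι) = (mehlerAverage a b G x).toReal := by
  have hm : Measurable fun y => G (a • x + b • y) := hG.comp (by fun_prop)
  have hae := (quasiMeasurePreserving_smul_add_smul_gaussianPi a hb x).ae hFG
  rw [mehlerAverage, integral_congr_ae hae,
    integral_toReal hm.aemeasurable (ae_of_all _ fun _ => (hGtop _).lt_top)]

end Mehler

section OrnsteinUhlenbeck

theorem exp_neg_sq_add_sqrt_sq {t : ℝ} (ht : 0 ≤ t) :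
    Real.exp (-t) ^ 2 + √(1 - Real.exp (-2 * t)) ^ 2 = 1 := by
  have h : Real.exp (-2 * t) ≤ 1 := Real.exp_le_one_iff.mpr (by linarith)
  rw [Real.sq_sqrt (by linarith), ← Real.exp_nat_mul]
  push_cast
  ring_nf

theorem sqrt_one_sub_exp_pos {t : ℝ} (ht : 0 < t) : 0 < √(1 - Real.exp (-2 * t)) :=
  Real.sqrt_pos.mpr (sub_pos.mpr (Real.exp_zero ▸ Real.exp_lt_exp.mpr (by linarith)))

theorem mehlerAverage_mehlerAverage_exp {ι : Type*} [Fintype ι] {t u : ℝ} (ht : 0 < t)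
    (htu : t ≤ u) {G : (ι → ℝ) → ℝ≥0∞} (hG : Measurable G) (x : ι → ℝ) :
    mehlerAverage (Real.exp (-(u - t))) √(1 - Real.exp (-2 * (u - t)))
        (mehlerAverage (Real.exp (-t)) √(1 - Real.exp (-2 * t)) G) x
      = mehlerAverage (Real.exp (-u)) √(1 - Real.exp (-2 * u)) G x := by
  have hu : 0 < u := ht.trans_le htu
  have hmul : Real.exp (-t) * Real.exp (-(u - t)) = Real.exp (-u) := by
    rw [← Real.exp_add]
    ring_nf
  rw [mehlerAverage_mehlerAverage (sqrt_one_sub_exp_pos hu) ?_ hG, hmul]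
  have e₁ := exp_neg_sq_add_sqrt_sq ht.le
  have e₂ := exp_neg_sq_add_sqrt_sq (sub_nonneg.mpr htu)
  have e₃ := exp_neg_sq_add_sqrt_sq hu.le
  rw [← hmul] at e₃
  linear_combination e₁ - e₃ + Real.exp (-t) ^ 2 * e₂

theorem exists_ouFlow_eq_toReal_mehlerAverage {n : ℕ} {F : (Fin n → ℝ) → ℝ}
    (hF0 : ∀ x, 0 ≤ F x) (hF : Integrable F (gaussianPi (Fin n))) :
    ∃ G : (Fin n → ℝ) → ℝ≥0∞, Measurable G ∧ ∫⁻ x, G x ∂(gaussianPi (Fin n)) ≠ ∞ ∧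
      ∀ t, 0 < t → ∀ x,
        ouFlow F t x = (mehlerAverage (Real.exp (-t)) √(1 - Real.exp (-2 * t)) G x).toReal := by
  have hmk := hF.aestronglyMeasurable.ae_eq_mk
  refine ⟨fun x => ENNReal.ofReal (hF.aestronglyMeasurable.mk F x),
    hF.aestronglyMeasurable.stronglyMeasurable_mk.measurable.ennreal_ofReal,
    (hF.congr hmk).lintegral_lt_top.ne, fun t ht x => ?_⟩
  refine integral_smul_add_smul_eq_toReal_mehlerAverage
    hF.aestronglyMeasurable.stronglyMeasurable_mk.measurable.ennreal_ofReal ?_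
    (fun _ => ENNReal.ofReal_ne_top) _ (sqrt_one_sub_exp_pos ht).ne' x
  filter_upwards [hmk] with y hy
  rw [← hy, ENNReal.toReal_ofReal (hF0 y)]

end OrnsteinUhlenbeck

/-- Ledoux's monotonicity underlying hypercontractivity of the Ornstein–Uhlenbeck
semigroup: with `B(x₁,x₂) = x₁^α₁ x₂^α₂`, `L₁ = (I 0)`, `L₂ = (ρI √(1-ρ²)I)` the quantity
`t ↦ ∫ B(U₁(t,L₁x), U₂(t,L₂x)) dγ(x)` is nondecreasing for `t > 0`. -/
theorem ou_hypercontractivity_monotone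
    {n : ℕ} (p q s ρ α₁ α₂ : ℝ)
    (hp : 1 < p) (hpq : p < q) (hs : 0 < s)
    (hcrit : Real.exp (2 * s) = (q - 1) / (p - 1))
    (hρ : ρ = Real.exp (-s)) (hα₁ : α₁ = 1 - 1 / q) (hα₂ : α₂ = 1 / p)
    (F₁ F₂ : (Fin n → ℝ) → ℝ)
    (hF₁_nonneg : ∀ x, 0 ≤ F₁ x) (hF₂_nonneg : ∀ x, 0 ≤ F₂ x)
    (hF₁_int : Integrable F₁ (gaussianPi (Fin n)))
    (hF₂_int : Integrable F₂ (gaussianPi (Fin n))) :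
    MonotoneOn (fun t =>
      ∫ x : (Fin n ⊕ Fin n) → ℝ,
        (ouFlow F₁ t (fun i => x (Sum.inl i))) ^ α₁
          * (ouFlow F₂ t (fun i => ρ * x (Sum.inl i)
              + Real.sqrt (1 - ρ ^ 2) * x (Sum.inr i))) ^ α₂
        ∂(gaussianPi (Fin n ⊕ Fin n)))
      (Set.Ioi (0:ℝ)) := by
  have hρσ : ρ ^ 2 + √(1 - ρ ^ 2) ^ 2 = 1 := by
    have hρ1 : ρ ^ 2 ≤ 1 := by
      rw [hρ, ← Real.exp_nat_mul, Real.exp_le_one_iff]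
      push_cast
      linarith
    rw [Real.sq_sqrt (by linarith)]
    ring
  have hp0 : 0 < p := by linarith
  have hq0 : 0 < q := by linarith
  have hρ2 : ρ ^ 2 * (q - 1) = p - 1 := by
    have h1 : ρ ^ 2 * Real.exp (2 * s) = 1 := by
      rw [hρ, ← Real.exp_nat_mul, ← Real.exp_add, Real.exp_eq_one_iff]
      push_cast
      ring
    rw [hcrit] at h1
    have : p - 1 ≠ 0 := by linarith
    field_simp at h1
    exact h1
  have hα₁0 : 0 < α₁ := by
    rw [hα₁, sub_pos, div_lt_one hq0]
    linarith
  have hα₁1 : α₁ < 1 := by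
    rw [hα₁]
    linarith [div_pos one_pos hq0]
  have hα₂0 : 0 < α₂ := by
    rw [hα₂]
    positivity
  have hα₂1 : α₂ < 1 := by
    rw [hα₂, div_lt_one hp0]
    exact hp
  have hexponents : ρ ^ 2 * (α₁ * α₂) = (1 - α₁) * (1 - α₂) := by
    rw [hα₁, hα₂]
    field_simp
    linear_combination hρ2
  obtain ⟨G₁, hG₁, hG₁i, h₁⟩ := exists_ouFlow_eq_toReal_mehlerAverage hF₁_nonneg hF₁_int
  obtain ⟨G₂, hG₂, hG₂i, h₂⟩ := exists_ouFlow_eq_toReal_mehlerAverage hF₂_nonneg hF₂_int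
  set Ψ : ℝ → ℝ≥0∞ := fun t => ∫⁻ w, mehlerAverage (Real.exp (-t)) √(1 - Real.exp (-2 * t)) G₁
      (sumMix (Fin n) 1 0 w) ^ α₁ * mehlerAverage (Real.exp (-t)) √(1 - Real.exp (-2 * t)) G₂
      (sumMix (Fin n) ρ √(1 - ρ ^ 2) w) ^ α₂ ∂(gaussianPi (Fin n ⊕ Fin n)) with hΨ
  have hm := fun t => measurable_mehlerAverage (Real.exp (-t)) √(1 - Real.exp (-2 * t)) hG₁
  have hm' := fun t => measurable_mehlerAverage (Real.exp (-t)) √(1 - Real.exp (-2 * t)) hG₂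
  have hi : ∀ t, 0 ≤ t → ∫⁻ x, mehlerAverage (Real.exp (-t)) √(1 - Real.exp (-2 * t)) G₁ x
      ∂(gaussianPi (Fin n)) ≠ ∞ := fun t ht => by
    rwa [lintegral_mehlerAverage (exp_neg_sq_add_sqrt_sq ht) hG₁]
  have hi' : ∀ t, 0 ≤ t → ∫⁻ x, mehlerAverage (Real.exp (-t)) √(1 - Real.exp (-2 * t)) G₂ x
      ∂(gaussianPi (Fin n)) ≠ ∞ := fun t ht => by
    rwa [lintegral_mehlerAverage (exp_neg_sq_add_sqrt_sq ht) hG₂]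
  have hΨtop : ∀ t, 0 ≤ t → Ψ t ≠ ∞ := fun t ht =>
    ne_top_of_le_ne_top (ENNReal.mul_ne_top (ENNReal.rpow_ne_top_of_nonneg hα₁0.le (hi t ht))
      (ENNReal.rpow_ne_top_of_nonneg hα₂0.le (hi' t ht)))
      (lintegral_rpow_mul_rpow_sumMix_le hα₁0 hα₁1 hα₂0 hα₂1 hρσ hexponents (hm t) (hm' t)
        (hi t ht) (hi' t ht))
  have hflow : ∀ t, 0 < t → ∫ x : (Fin n ⊕ Fin n) → ℝ,
        (ouFlow F₁ t (fun i => x (Sum.inl i))) ^ α₁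
          * (ouFlow F₂ t (fun i => ρ * x (Sum.inl i)
              + Real.sqrt (1 - ρ ^ 2) * x (Sum.inr i))) ^ α₂
        ∂(gaussianPi (Fin n ⊕ Fin n)) = (Ψ t).toReal := by
    intro t ht
    have hmeas : Measurable fun w => mehlerAverage (Real.exp (-t)) √(1 - Real.exp (-2 * t)) G₁
        (sumMix (Fin n) 1 0 w) ^ α₁ * mehlerAverage (Real.exp (-t)) √(1 - Real.exp (-2 * t)) G₂
        (sumMix (Fin n) ρ √(1 - ρ ^ 2) w) ^ α₂ :=
      (((hm t).comp (sumMix (Fin n) 1 0).measurable).pow_const α₁).mul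
        (((hm' t).comp (sumMix (Fin n) ρ √(1 - ρ ^ 2)).measurable).pow_const α₂)
    rw [hΨ, ← integral_toReal hmeas.aemeasurable (ae_lt_top hmeas (hΨtop t ht.le))]
    refine integral_congr_ae (ae_of_all _ fun w => ?_)
    have e : (fun i => w (Sum.inl i)) = sumMix (Fin n) 1 0 w := by
      ext i
      simp [sumMix_apply]
    simp only [ENNReal.toReal_mul, ← ENNReal.toReal_rpow, h₁ t ht, h₂ t ht, e]
    rfl
  have hΨmono : ∀ t u, 0 < t → t ≤ u → Ψ t ≤ Ψ u := by
    intro t u ht htu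
    refine (lintegral_rpow_mul_rpow_le_mehlerAverage hα₁0 hα₁1 hα₂0 hα₂1 hρσ hexponents
      (exp_neg_sq_add_sqrt_sq (sub_nonneg.mpr htu)) (hm t) (hm' t) (hi t ht.le)
      (hi' t ht.le)).trans_eq ?_
    simp only [hΨ, mehlerAverage_mehlerAverage_exp ht htu hG₁,
      mehlerAverage_mehlerAverage_exp ht htu hG₂]
  intro t ht u hu htu
  simp only [hflow t ht, hflow u hu]
  exact ENNReal.toReal_mono (hΨtop u (le_of_lt hu)) (hΨmono t u ht htu)
end
end

section
/- Let A be a symmetric positive-definite n×n real matrix, and let B : (0,∞)² → (0,∞) be a twice differentiable function that is increasing in each variable and homogeneous of degree 1. Define Θ(x₁,x₂) := log B(e^{x₁}, e^{x₂}). Then: the log-convexity estimate D²(log u) ≥ −A/(2t) is preserved under B — i.e. whenever smooth positive u₁, u₂ : (0,∞) × ℝⁿ → (0,∞) both satisfy D²(log u_j) ≥ −A/(2t), the function ũ := B(u₁,u₂) satisfies D²(log ũ) ≥ −A/(2t) — if and only if Θ is convex. Moreover, if the scalar function h := Θ(0,·) is strictly concave at some point, then there exist positive solutions u₁, u₂ of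 the heat equation ∂_t u = Δu on ℝⁿ (indeed translated heat kernels) such that ũ := B(u₁,u₂) fails the estimate Δ(log ũ) ≥ −n/(2t), and hence fails D²(log ũ) ≥ −I/(2t), at the given point (t,x). -/
noncomputable section
open Real MeasureTheory Matrix Set

/-- Hessian matrix. -/
def hess' {ι : Type*} [Fintype ι] [DecidableEq ι] (f : (ι → ℝ) → ℝ) (x : ι → ℝ) :
    Matrix ι ι ℝ :=
  Matrix.of fun i j => pd (fun y => pd f j y) i x

/-- The translated heat kernel `e^{tΔ}δ_a` on `ℝⁿ`. -/
def heatKernel (n : ℕ) (a : Fin n → ℝ) (t : ℝ) (x : Fin n → ℝ) : ℝ :=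
  (4 * π * t) ^ (-(n : ℝ) / 2) * Real.exp (-(∑ i, (x i - a i) ^ 2) / (4 * t))

/-- The quadratic polynomial with leading form `k • A`, linear part `b` and constant part `c`. -/
def quadPoly {ι : Type*} [Fintype ι] (k : ℝ) (A : Matrix ι ι ℝ) (b : ι → ℝ) (c : ℝ)
    (y : ι → ℝ) : ℝ :=
  k * (y ⬝ᵥ A *ᵥ y) + b ⬝ᵥ y + c

lemma contDiff_quadPoly {ι : Type*} [Fintype ι] (k : ℝ) (A : Matrix ι ι ℝ) (b : ι → ℝ)
    (c : ℝ) {m : WithTop ℕ∞} : ContDiff ℝ m (quadPoly k A b c) := by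
  unfold quadPoly
  simp only [dotProduct, mulVec]
  fun_prop

section Derivatives

variable {ι : Type*} [Fintype ι] [DecidableEq ι]

lemma pd_add_comp_sub {f g : (ι → ℝ) → ℝ} {φ : ℝ → ℝ} {x : ι → ℝ}
    (hf : DifferentiableAt ℝ f x) (hg : DifferentiableAt ℝ g x)
    (hφ : DifferentiableAt ℝ φ (g x - f x)) (i : ι) :
    pd (fun y => f y + φ (g y - f y)) i x
      = pd f i x + deriv φ (g x - f x) * (pd g i x - pd f i x) := by
  have H := hf.hasFDerivAt.add
    (hφ.hasDerivAt.comp_hasFDerivAt x (hg.hasFDerivAt.sub hf.hasFDerivAt))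
  have H' : HasFDerivAt (fun y => f y + φ (g y - f y)) _ x := H
  simp [pd, H'.fderiv]

lemma differentiable_pd {f : (ι → ℝ) → ℝ} (hf : ContDiff ℝ 2 f) (i : ι) :
    Differentiable ℝ (pd f i) :=
  ((hf.fderiv_right (m := 1) (by norm_num)).clm_apply contDiff_const).differentiable (by norm_num)

lemma hess'_add_comp_sub {f g : (ι → ℝ) → ℝ} {φ : ℝ → ℝ}
    (hf : ContDiff ℝ 2 f) (hg : ContDiff ℝ 2 g) (hφ : ContDiff ℝ 2 φ) (x : ι → ℝ) :
    hess' (fun y => f y + φ (g y - f y)) x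
      = (1 - deriv φ (g x - f x)) • hess' f x + deriv φ (g x - f x) • hess' g x
        + deriv (deriv φ) (g x - f x) •
          vecMulVec (fun i => pd g i x - pd f i x) (fun i => pd g i x - pd f i x) := by
  ext i j
  have hfd := hf.differentiable (by norm_num)
  have hgd := hg.differentiable (by norm_num)
  have hφd := hφ.differentiable (by norm_num)
  have hφ' : Differentiable ℝ (deriv φ) := hφ.differentiable_deriv_two
  have hpf := (differentiable_pd hf j x).hasFDerivAt
  have hpg := (differentiable_pd hg j x).hasFDerivAt
  have H := hpf.add (((hφ' (g x - f x)).hasDerivAt.comp_hasFDerivAt x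
    ((hgd x).hasFDerivAt.sub (hfd x).hasFDerivAt)).mul (hpg.sub hpf))
  have H' : HasFDerivAt (fun y => pd f j y + deriv φ (g y - f y) * (pd g j y - pd f j y)) _ x := H
  have key : (fun y => pd (fun y => f y + φ (g y - f y)) j y)
      = fun y => pd f j y + deriv φ (g y - f y) * (pd g j y - pd f j y) :=
    funext fun y => pd_add_comp_sub (hfd y) (hgd y) (hφd _) j
  simp only [hess', of_apply, key, Matrix.add_apply, Matrix.smul_apply, smul_eq_mul,
    vecMulVec_apply]
  unfold pd at H' ⊢
  rw [H'.fderiv]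
  simp
  ring

lemma pd_quadPoly (k : ℝ) {A : Matrix ι ι ℝ} (hA : A.IsSymm) (b : ι → ℝ) (c : ℝ)
    (i : ι) (y : ι → ℝ) : pd (quadPoly k A b c) i y = 2 * k * (A *ᵥ y) i + b i := by
  have hline : HasDerivAt (fun s : ℝ => quadPoly k A b c (y + s • Pi.single i 1))
      (pd (quadPoly k A b c) i y) 0 := by
    have hd := ((contDiff_quadPoly k A b c (m := 1)).differentiable (by norm_num) y).hasFDerivAt
    exact hd.hasLineDerivAt (Pi.single i 1)
  have hsymm : y ⬝ᵥ A *ᵥ Pi.single i 1 = (A *ᵥ y) i := by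
    rw [dotProduct_mulVec, ← mulVec_transpose, hA.eq]; simp
  have hexp : (fun s : ℝ => quadPoly k A b c (y + s • Pi.single i 1))
      = fun s => quadPoly k A b c y + s * (2 * k * (A *ᵥ y) i + b i) + s ^ 2 * (k * A i i) := by
    funext s
    simp only [quadPoly, mulVec_add, mulVec_smul, dotProduct_add, add_dotProduct, smul_dotProduct,
      dotProduct_smul, hsymm, single_one_dotProduct, dotProduct_single_one, smul_eq_mul]
    simp
    ring
  rw [hexp] at hline
  refine hline.unique ?_
  have H : HasDerivAt (fun s : ℝ => quadPoly k A b c y + s * (2 * k * (A *ᵥ y) i + b i)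
      + s ^ 2 * (k * A i i)) _ 0 :=
    (((hasDerivAt_id' (0 : ℝ)).mul_const (2 * k * (A *ᵥ y) i + b i)).const_add
      (quadPoly k A b c y)).add ((hasDerivAt_pow 2 (0 : ℝ)).mul_const (k * A i i))
  exact H.congr_deriv (by simp)

lemma hess'_quadPoly (k : ℝ) {A : Matrix ι ι ℝ} (hA : A.IsSymm) (b : ι → ℝ) (c : ℝ)
    (y : ι → ℝ) : hess' (quadPoly k A b c) y = (2 * k) • A := by
  ext i j
  have h : (fun y => pd (quadPoly k A b c) j y) = quadPoly 0 A ((2 * k) • A j) (b j) := by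
    funext y
    simp [pd_quadPoly k hA, quadPoly, mulVec]
  simp [hess', h, pd_quadPoly 0 hA, hA.apply]

end Derivatives

section Homogeneous

variable {B : ℝ → ℝ → ℝ}

lemma log_eq_add_of_homogeneous
    (hB_pos : ∀ x₁ x₂ : ℝ, 0 < x₁ → 0 < x₂ → 0 < B x₁ x₂)
    (hB_hom : ∀ c > (0:ℝ), ∀ x₁ > (0:ℝ), ∀ x₂ > (0:ℝ), B (c * x₁) (c * x₂) = c * B x₁ x₂)
    {x₁ x₂ : ℝ} (h₁ : 0 < x₁) (h₂ : 0 < x₂) :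
    log (B x₁ x₂) = log x₁ + log (B 1 (exp (log x₂ - log x₁))) := by
  rw [exp_sub, exp_log h₁, exp_log h₂, ← log_mul h₁.ne' (hB_pos _ _ one_pos (by positivity)).ne',
    ← hB_hom x₁ h₁ 1 one_pos _ (div_pos h₂ h₁), mul_one, mul_div_cancel₀ _ h₁.ne']

lemma contDiff_log_one_exp
    (hB_smooth : ContDiffOn ℝ 2 (fun p : ℝ × ℝ => B p.1 p.2) {p | 0 < p.1 ∧ 0 < p.2})
    (hB_pos : ∀ x₁ x₂ : ℝ, 0 < x₁ → 0 < x₂ → 0 < B x₁ x₂) :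
    ContDiff ℝ 2 fun s => log (B 1 (exp s)) := by
  have hc : ContDiff ℝ 2 fun s : ℝ => ((1 : ℝ), exp s) := by fun_prop
  have := hB_smooth.comp (s := univ) hc.contDiffOn fun s _ => ⟨one_pos, exp_pos s⟩
  exact (contDiffOn_univ.1 this).log fun s => (hB_pos _ _ one_pos (exp_pos s)).ne'

lemma monotone_log_one_exp
    (hB_pos : ∀ x₁ x₂ : ℝ, 0 < x₁ → 0 < x₂ → 0 < B x₁ x₂)
    (hB_mono : ∀ x₁ x₂ y₁ y₂ : ℝ, 0 < x₁ → 0 < x₂ → x₁ ≤ y₁ → x₂ ≤ y₂ →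
      B x₁ x₂ ≤ B y₁ y₂) :
    Monotone fun s => log (B 1 (exp s)) := fun s _ hsr =>
  log_le_log (hB_pos _ _ one_pos (exp_pos s))
    (hB_mono _ _ _ _ one_pos (exp_pos s) le_rfl (exp_le_exp.2 hsr))

lemma monotone_id_sub_log_one_exp
    (hB_pos : ∀ x₁ x₂ : ℝ, 0 < x₁ → 0 < x₂ → 0 < B x₁ x₂)
    (hB_mono : ∀ x₁ x₂ y₁ y₂ : ℝ, 0 < x₁ → 0 < x₂ → x₁ ≤ y₁ → x₂ ≤ y₂ →
      B x₁ x₂ ≤ B y₁ y₂)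
    (hB_hom : ∀ c > (0:ℝ), ∀ x₁ > (0:ℝ), ∀ x₂ > (0:ℝ), B (c * x₁) (c * x₂) = c * B x₁ x₂) :
    Monotone fun s => s - log (B 1 (exp s)) := by
  have key (s : ℝ) : s - log (B 1 (exp s)) = -log (B (exp (-s)) 1) := by
    have := log_eq_add_of_homogeneous hB_pos hB_hom (exp_pos (-s)) one_pos
    simp only [log_exp, log_one, zero_sub, neg_neg] at this
    rw [this]; ring
  intro s _ hsr
  simp only [key]
  exact neg_le_neg (log_le_log (hB_pos _ _ (exp_pos _) one_pos)
    (hB_mono _ _ _ _ (exp_pos _) one_pos (exp_le_exp.2 (neg_le_neg hsr)) le_rfl))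

end Homogeneous

lemma convexOn_univ_iff_deriv2_nonneg {φ : ℝ → ℝ} (hφ : ContDiff ℝ 2 φ) :
    ConvexOn ℝ univ φ ↔ ∀ s, 0 ≤ deriv (deriv φ) s := by
  have hd : Differentiable ℝ φ := hφ.differentiable (by norm_num)
  refine ⟨fun hc s => ?_, fun hn => ?_⟩
  · have : Monotone (deriv φ) := monotoneOn_univ.1 (hc.monotoneOn_deriv fun s _ => hd s)
    exact this.deriv_nonneg
  · exact convexOn_univ_of_deriv2_nonneg hd hφ.differentiable_deriv_two hn

lemma convexOn_add_comp_sub_iff {φ : ℝ → ℝ} :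
    ConvexOn ℝ univ (fun s : ℝ × ℝ => s.1 + φ (s.2 - s.1)) ↔ ConvexOn ℝ univ φ := by
  refine ⟨fun hc => ?_, fun hc => ?_⟩
  · simpa [Function.comp_def] using hc.comp_linearMap (LinearMap.inr ℝ ℝ ℝ)
  · exact ((LinearMap.fst ℝ ℝ ℝ).convexOn convex_univ).add
      (hc.comp_linearMap (LinearMap.snd ℝ ℝ ℝ - LinearMap.fst ℝ ℝ ℝ))

lemma heatKernel_pos {n : ℕ} (a : Fin n → ℝ) {t : ℝ} (ht : 0 < t) (x : Fin n → ℝ) :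
    0 < heatKernel n a t x :=
  mul_pos (rpow_pos_of_pos (by positivity) _) (exp_pos _)

lemma log_heatKernel {n : ℕ} (a : Fin n → ℝ) {t : ℝ} (ht : 0 < t) :
    (fun y => log (heatKernel n a t y))
      = quadPoly (-1 / (4 * t)) 1 ((1 / (2 * t)) • a)
          (log ((4 * π * t) ^ (-(n : ℝ) / 2)) - (a ⬝ᵥ a) / (4 * t)) := by
  funext y
  rw [heatKernel, log_mul (rpow_pos_of_pos (by positivity) _).ne' (exp_pos _).ne', log_exp]
  have : ∑ i, (y i - a i) ^ 2 = y ⬝ᵥ y - 2 * (a ⬝ᵥ y) + a ⬝ᵥ a := by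
    simp only [dotProduct, Finset.mul_sum, ← Finset.sum_sub_distrib, ← Finset.sum_add_distrib]
    exact Finset.sum_congr rfl fun i _ => by ring
  simp only [quadPoly, this, one_mulVec, smul_dotProduct, smul_eq_mul]
  field_simp
  ring

lemma contDiff_log_slice {n : ℕ} {u : ℝ → (Fin n → ℝ) → ℝ}
    (hu : ContDiffOn ℝ (⊤ : ℕ∞) (Function.uncurry u) (Ioi (0:ℝ) ×ˢ univ))
    {t : ℝ} (ht : 0 < t) (hpos : ∀ x, 0 < u t x) : ContDiff ℝ 2 fun y => log (u t y) := by
  have hc : ContDiff ℝ (⊤ : ℕ∞) fun y : Fin n → ℝ => (t, y) := by fun_prop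
  have := contDiffOn_univ.1 (hu.comp (s := univ) hc.contDiffOn fun y _ => ⟨ht, mem_univ y⟩)
  exact (this.of_le (by norm_cast)).log fun y => (hpos y).ne'

/-- For an increasing, degree-one homogeneous `B`, the matrix Li–Yau estimate is
preserved under `B` if and only if `Θ(s₁,s₂) = log B(e^{s₁},e^{s₂})` is convex; and if
`h = Θ(0,·)` is strictly concave at some point, translated heat kernels produce a
counterexample at every given point `(t,x)`. -/
theorem liYau_preserved_iff_Theta_convex
    {n : ℕ} (hn : 0 < n) (A : Matrix (Fin n) (Fin n) ℝ) (hA : A.PosDef)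
    (B : ℝ → ℝ → ℝ)
    (hB_smooth : ContDiffOn ℝ 2 (fun p : ℝ × ℝ => B p.1 p.2) {p | 0 < p.1 ∧ 0 < p.2})
    (hB_pos : ∀ x₁ x₂ : ℝ, 0 < x₁ → 0 < x₂ → 0 < B x₁ x₂)
    (hB_mono : ∀ x₁ x₂ y₁ y₂ : ℝ, 0 < x₁ → 0 < x₂ → x₁ ≤ y₁ → x₂ ≤ y₂ →
      B x₁ x₂ ≤ B y₁ y₂)
    (hB_hom : ∀ c > (0:ℝ), ∀ x₁ > (0:ℝ), ∀ x₂ > (0:ℝ), B (c * x₁) (c * x₂) = c * B x₁ x₂)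
    (Θ : ℝ × ℝ → ℝ) (hΘ : Θ = fun s => Real.log (B (Real.exp s.1) (Real.exp s.2)))
    (h : ℝ → ℝ) (hh : h = fun s => Θ (0, s)) :
    ((∀ u₁ u₂ : ℝ → (Fin n → ℝ) → ℝ,
        ContDiffOn ℝ (⊤ : ℕ∞) (Function.uncurry u₁) (Set.Ioi (0:ℝ) ×ˢ Set.univ) →
        ContDiffOn ℝ (⊤ : ℕ∞) (Function.uncurry u₂) (Set.Ioi (0:ℝ) ×ˢ Set.univ) →
        (∀ t > (0:ℝ), ∀ x, 0 < u₁ t x) → (∀ t > (0:ℝ), ∀ x, 0 < u₂ t x) →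
        (∀ t > (0:ℝ), ∀ x,
          (hess' (fun y => Real.log (u₁ t y)) x + (1 / (2 * t)) • A).PosSemidef) →
        (∀ t > (0:ℝ), ∀ x,
          (hess' (fun y => Real.log (u₂ t y)) x + (1 / (2 * t)) • A).PosSemidef) →
        (∀ t > (0:ℝ), ∀ x,
          (hess' (fun y => Real.log (B (u₁ t y) (u₂ t y))) x
            + (1 / (2 * t)) • A).PosSemidef))
      ↔ ConvexOn ℝ Set.univ Θ)
    ∧ ((∃ s₀, deriv (deriv h) s₀ < 0) →
        ∀ t > (0:ℝ), ∀ x : Fin n → ℝ, ∃ a₁ a₂ : Fin n → ℝ,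
          ∑ i, hess' (fun y =>
              Real.log (B (heatKernel n a₁ t y) (heatKernel n a₂ t y))) x i i
            < -(n : ℝ) / (2 * t)) := by
  have hlog {x₁ x₂ : ℝ} (h₁ : 0 < x₁) (h₂ : 0 < x₂) :
      log (B x₁ x₂) = log x₁ + h (log x₂ - log x₁) := by
    simpa [hh, hΘ] using log_eq_add_of_homogeneous hB_pos hB_hom h₁ h₂
  have hh' : h = fun s => log (B 1 (exp s)) := by simp [hh, hΘ]
  have hC2 : ContDiff ℝ 2 h := hh' ▸ contDiff_log_one_exp hB_smooth hB_pos
  have hd : Differentiable ℝ h := hC2.differentiable (by norm_num)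
  have hnonneg (s : ℝ) : 0 ≤ deriv h s :=
    (hh' ▸ monotone_log_one_exp hB_pos hB_mono : Monotone h).deriv_nonneg
  have hle (s : ℝ) : 0 ≤ 1 - deriv h s := by
    have hm : Monotone fun s => s - h s := by
      simpa only [hh'] using monotone_id_sub_log_one_exp hB_pos hB_mono hB_hom
    have := hm.deriv_nonneg (x := s)
    have hsub : HasDerivAt (fun s => s - h s) (1 - deriv h s) s :=
      (hasDerivAt_id' s).sub (hd s).hasDerivAt
    rwa [hsub.deriv] at this
  have hΘ' : Θ = fun s => s.1 + h (s.2 - s.1) := by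
    funext s
    simpa [hΘ] using hlog (exp_pos s.1) (exp_pos s.2)
  rw [hΘ', convexOn_add_comp_sub_iff, convexOn_univ_iff_deriv2_nonneg hC2]
  refine ⟨⟨fun H s => ?_, fun hconv u₁ u₂ hu₁ hu₂ hp₁ hp₂ hL₁ hL₂ t ht x => ?_⟩, ?_⟩
  · have hAs : A.IsSymm := by simpa [IsHermitian, IsSymm] using hA.isHermitian
    let e : Fin n → ℝ := Pi.single ⟨0, hn⟩ 1
    let u (b : Fin n → ℝ) (t : ℝ) (y : Fin n → ℝ) : ℝ := exp (quadPoly (-1 / (4 * t)) A b 0 y)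
    have hu (b : Fin n → ℝ) :
        ContDiffOn ℝ (⊤ : ℕ∞) (Function.uncurry (u b)) (Ioi (0:ℝ) ×ˢ univ) := by
      simp only [u, quadPoly, dotProduct, mulVec, Function.uncurry_def]
      refine ContDiffOn.exp ?_
      have hk : ContDiffOn ℝ (⊤ : ℕ∞) (fun p : ℝ × (Fin n → ℝ) => -1 / (4 * p.1))
          (Ioi (0:ℝ) ×ˢ univ) :=
        contDiffOn_const.div (by fun_prop) fun p hp => by
          have : 0 < p.1 := hp.1
          positivity
      fun_prop
    have hlu (b : Fin n → ℝ) (t : ℝ) :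
        (fun y => log (u b t y)) = quadPoly (-1 / (4 * t)) A b 0 := by
      simp [u]
    have hL (b : Fin n → ℝ) (t : ℝ) (ht : 0 < t) (x : Fin n → ℝ) :
        (hess' (fun y => log (u b t y)) x + (1 / (2 * t)) • A).PosSemidef := by
      rw [hlu, hess'_quadPoly _ hAs, ← add_smul]
      convert PosSemidef.zero
      convert zero_smul ℝ A
      field_simp
      norm_num
    have hP := H (u 0) (u e) (hu 0) (hu e) (fun _ _ _ => exp_pos _) (fun _ _ _ => exp_pos _)
      (hL 0) (hL e) 1 one_pos (s • e)
    have heq : (fun y => log (B (u 0 1 y) (u e 1 y))) = fun y =>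
        quadPoly (-1 / (4 * 1)) A 0 0 y
          + h (quadPoly (-1 / (4 * 1)) A e 0 y - quadPoly (-1 / (4 * 1)) A 0 0 y) := by
      funext y
      rw [hlog (exp_pos _) (exp_pos _), log_exp, log_exp]
    rw [heq, hess'_add_comp_sub (contDiff_quadPoly ..) (contDiff_quadPoly ..) hC2,
      hess'_quadPoly _ hAs, hess'_quadPoly _ hAs] at hP
    have hval : quadPoly (-1 / (4 * 1)) A e 0 (s • e) - quadPoly (-1 / (4 * 1)) A 0 0 (s • e)
        = s := by
      simp [quadPoly, e]
    have := hP.diag_nonneg (i := ⟨0, hn⟩)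
    simp only [hval, pd_quadPoly _ hAs, Matrix.add_apply, Matrix.smul_apply, smul_eq_mul,
      vecMulVec_apply, e, Pi.single_eq_same, Pi.zero_apply] at this
    linarith
  · have heq : (fun y => log (B (u₁ t y) (u₂ t y))) = fun y =>
        log (u₁ t y) + h (log (u₂ t y) - log (u₁ t y)) :=
      funext fun y => hlog (hp₁ t ht y) (hp₂ t ht y)
    rw [heq, hess'_add_comp_sub (contDiff_log_slice hu₁ ht (hp₁ t ht))
      (contDiff_log_slice hu₂ ht (hp₂ t ht)) hC2]
    set s := log (u₂ t x) - log (u₁ t x)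
    set p := fun i => pd (fun y => log (u₂ t y)) i x - pd (fun y => log (u₁ t y)) i x
    have hvec : (vecMulVec p p).PosSemidef := by
      simpa using posSemidef_vecMulVec_self_star p
    convert (((hL₁ t ht x).smul (hle s)).add ((hL₂ t ht x).smul (hnonneg s))).add
      (hvec.smul (hconv s)) using 1
    module
  · rintro ⟨s₀, hs₀⟩ t ht x
    let e : Fin n → ℝ := Pi.single ⟨0, hn⟩ 1
    let a₁ := x + ((4 * t * s₀ + 1) / 2) • e
    let a₂ := x + ((4 * t * s₀ - 1) / 2) • e
    refine ⟨a₁, a₂, ?_⟩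
    have heq : (fun y => log (B (heatKernel n a₁ t y) (heatKernel n a₂ t y))) = fun y =>
        log (heatKernel n a₁ t y) + h (log (heatKernel n a₂ t y) - log (heatKernel n a₁ t y)) :=
      funext fun y => hlog (heatKernel_pos a₁ ht y) (heatKernel_pos a₂ ht y)
    have hval : log (heatKernel n a₂ t x) - log (heatKernel n a₁ t x) = s₀ := by
      have hc : (4 * π * t) ^ (-(n : ℝ) / 2) ≠ 0 := (rpow_pos_of_pos (by positivity) _).ne'
      simp only [heatKernel, log_mul hc (exp_pos _).ne', log_exp]
      simp [a₁, a₂, e, Pi.single_apply, ite_pow]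
      field_simp
      ring
    have hsm (a : Fin n → ℝ) : ContDiff ℝ 2 fun y => log (heatKernel n a t y) := by
      rw [log_heatKernel a ht]
      exact contDiff_quadPoly ..
    have hp : (fun i => pd (fun y => log (heatKernel n a₂ t y)) i x
        - pd (fun y => log (heatKernel n a₁ t y)) i x) = (-1 / (2 * t)) • e := by
      funext i
      simp only [log_heatKernel _ ht, pd_quadPoly _ isSymm_one, a₁, a₂, Pi.smul_apply,
        Pi.add_apply, smul_eq_mul]
      ring
    rw [heq, hess'_add_comp_sub (hsm a₁) (hsm a₂) hC2, hval, hp]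
    simp only [log_heatKernel _ ht, hess'_quadPoly _ isSymm_one]
    change trace _ < _
    have hlt : deriv (deriv h) s₀ * (-1 / (2 * t)) ^ 2 < 0 :=
      mul_neg_of_neg_of_pos hs₀ (by have := ht.ne'; positivity)
    have : trace ((1 - deriv h s₀) • (2 * (-1 / (4 * t))) • (1 : Matrix (Fin n) (Fin n) ℝ)
        + deriv h s₀ • (2 * (-1 / (4 * t))) • (1 : Matrix (Fin n) (Fin n) ℝ)
        + deriv (deriv h) s₀ • vecMulVec ((-1 / (2 * t)) • e) ((-1 / (2 * t)) • e))
        = -(n : ℝ) / (2 * t) + deriv (deriv h) s₀ * (-1 / (2 * t)) ^ 2 := by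
      simp [trace_add, trace_smul, trace_vecMulVec, e]
      field_simp
      ring
    rw [this]
    linarith
end
end

section
/- Suppose B : (0,∞)^m → (0,∞) is twice differentiable, increasing in each variable, and there exists λ ≥ 0 such that D²B(x) ≤ λ·diag(∂₁B(x)/x₁, …, ∂_mB(x)/x_m) for all x ∈ (0,∞)^m, and that B extends continuously to 0 with B(0) ≥ 0. Then (1+λ)B(x) − Σ_{j=1}^m ∂_jB(x) x_j ≥ 0 for all x ∈ (0,∞)^m. -/
noncomputable section
open Real MeasureTheory Matrix Set

theorem fderiv_apply_eq_sum_pd {ι : Type*} [Fintype ι] [DecidableEq ι] (f : (ι → ℝ) → ℝ)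
    (x v : ι → ℝ) : fderiv ℝ f x v = ∑ i, pd f i x * v i := by
  conv_lhs => rw [pi_eq_sum_univ' v]
  simp [pd, map_sum, mul_comm]

theorem hasDerivAt_comp_smul {ι : Type*} [Fintype ι] [DecidableEq ι] {f : (ι → ℝ) → ℝ}
    {x : ι → ℝ} {t : ℝ} (hf : DifferentiableAt ℝ f (t • x)) :
    HasDerivAt (fun s : ℝ => f (s • x)) (∑ i, pd f i (t • x) * x i) t := by
  rw [← fderiv_apply_eq_sum_pd]
  have h : HasDerivAt (fun s : ℝ => s • x) x t := by
    simpa using (hasDerivAt_id t).smul_const x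
  exact hf.hasFDerivAt.comp_hasDerivAt t h

theorem differentiableAt_pd {ι : Type*} [Fintype ι] [DecidableEq ι] {f : (ι → ℝ) → ℝ}
    {y : ι → ℝ} (hf : ContDiffAt ℝ 2 f y) (i : ι) : DifferentiableAt ℝ (pd f i) y := by
  have h : ContDiffAt ℝ 1 (fderiv ℝ f) y := hf.fderiv_right (by norm_num)
  exact (h.differentiableAt (by norm_num)).clm_apply (differentiableAt_const _)

theorem isOpen_forall_pos {ι : Type*} [Finite ι] : IsOpen {x : ι → ℝ | ∀ i, 0 < x i} := by
  simp only [Set.ofPred_forall]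
  exact isOpen_iInter_of_finite fun i => isOpen_lt continuous_const (continuous_apply i)

/-- A positive function on the half-line satisfies `t g'(t) ≤ a g(t)` with `a ≥ 0` as soon as
`a g(t) - t g'(t)` is nondecreasing: otherwise `g` would drop below a multiple of `log`. -/
theorem nonneg_of_monotoneOn_sub_mul_deriv {g g' : ℝ → ℝ} {a : ℝ} (ha : 0 ≤ a)
    (hg : ∀ t, 0 < t → HasDerivAt g (g' t) t) (hpos : ∀ t, 0 < t → 0 < g t)
    (hmono : MonotoneOn (fun t => a * g t - t * g' t) (Ioi 0)) :
    0 ≤ a * g 1 - g' 1 := by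
  by_contra! hneg
  set c := g' 1 - a * g 1 with hc
  have hc0 : 0 < c := by linarith
  have hder : ∀ t, 0 < t → HasDerivAt (fun s => g s - c * Real.log s) (g' t - c * t⁻¹) t :=
    fun t ht => (hg t ht).sub ((Real.hasDerivAt_log ht.ne').const_mul c)
  have hmono' : MonotoneOn (fun s => g s - c * Real.log s) (Ioc 0 1) := by
    refine monotoneOn_of_deriv_nonneg (convex_Ioc 0 1)
      (fun t ht => (hder t ht.1).continuousAt.continuousWithinAt) ?_ ?_ <;>
      rw [interior_Ioc]
    · exact fun t ht => (hder t ht.1).differentiableAt.differentiableWithinAt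
    · intro t ht
      rw [(hder t ht.1).deriv]
      have h1 : a * g t - t * g' t ≤ a * g 1 - 1 * g' 1 :=
        hmono (mem_Ioi.2 ht.1) (mem_Ioi.2 one_pos) ht.2.le
      have h2 : 0 ≤ a * g t := mul_nonneg ha (hpos t ht.1).le
      have h3 : c / t ≤ g' t := by
        rw [div_le_iff₀ ht.1]
        linarith
      rw [div_eq_mul_inv] at h3
      linarith
  have hg1 := hpos 1 one_pos
  have hle : Real.exp (-(g 1 / c)) ≤ 1 :=
    Real.exp_le_one_iff.2 (neg_nonpos.2 (div_pos hg1 hc0).le)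
  have h := hmono' ⟨Real.exp_pos _, hle⟩ ⟨one_pos, le_rfl⟩ hle
  simp only [Real.log_exp, Real.log_one] at h
  have h4 : c * (g 1 / c) = g 1 := mul_div_cancel₀ _ hc0.ne'
  have h5 := hpos _ (Real.exp_pos (-(g 1 / c)))
  linarith

/-- If `D²B ≤ λ diag(∂₁B/x₁,…,∂_mB/x_m)`, `B` is increasing in each variable, and `B`
extends continuously to `0` with `B(0) ≥ 0`, then `(1+λ)B(x) - Σ_j ∂_jB(x)·x_j ≥ 0`. -/
theorem general_concavity_Euler_bound
    {m : ℕ} (B : (Fin m → ℝ) → ℝ)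
    (hB_smooth : ContDiffOn ℝ 2 B {x | ∀ i, 0 < x i})
    (hB_pos : ∀ x, (∀ i, 0 < x i) → 0 < B x)
    (hB_mono : ∀ x, (∀ i, (0:ℝ) < x i) → ∀ j, 0 ≤ pd B j x)
    (lam : ℝ) (hlam : 0 ≤ lam)
    (hB_hess : ∀ x, (∀ i, (0:ℝ) < x i) →
      (lam • Matrix.diagonal (fun j => pd B j x / x j) - hess' B x).PosSemidef)
    (B₀ : ℝ) (hB₀_nonneg : 0 ≤ B₀)
    (hB₀ : Filter.Tendsto B (nhdsWithin 0 {x : Fin m → ℝ | ∀ i, 0 < x i}) (nhds B₀)) :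
    ∀ x, (∀ i, (0:ℝ) < x i) → 0 ≤ (1 + lam) * B x - ∑ j, pd B j x * x j := by
  intro x hx
  have hpos : ∀ t : ℝ, 0 < t → ∀ i, 0 < (t • x) i := fun t ht i => mul_pos ht (hx i)
  have hsm : ∀ t : ℝ, 0 < t → ContDiffAt ℝ 2 B (t • x) := fun t ht =>
    hB_smooth.contDiffAt (isOpen_forall_pos.mem_nhds (hpos t ht))
  have hg : ∀ t : ℝ, 0 < t →
      HasDerivAt (fun s : ℝ => B (s • x)) (∑ j, pd B j (t • x) * x j) t := fun t ht =>
    hasDerivAt_comp_smul ((hsm t ht).differentiableAt (by norm_num))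
  have hg' : ∀ t : ℝ, 0 < t → HasDerivAt (fun s : ℝ => ∑ j, pd B j (s • x) * x j)
      (∑ j, (∑ i, pd (pd B j) i (t • x) * x i) * x j) t := fun t ht =>
    HasDerivAt.fun_sum fun j _ =>
      (hasDerivAt_comp_smul (differentiableAt_pd (hsm t ht) j)).mul_const (x j)
  have hH : ∀ t : ℝ, 0 < t → ∑ j, (∑ i, pd (pd B j) i (t • x) * x i) * x j ≤
      lam * ((∑ j, pd B j (t • x) * x j) / t) := by
    intro t ht
    have h := (hB_hess (t • x) (hpos t ht)).dotProduct_mulVec_nonneg x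
    have h1 : star x ⬝ᵥ (hess' B (t • x) *ᵥ x) =
        ∑ j, (∑ i, pd (pd B j) i (t • x) * x i) * x j := by
      simp only [dotProduct, mulVec, hess', of_apply, star_trivial, Finset.mul_sum, Finset.sum_mul]
      rw [Finset.sum_comm]
      exact Finset.sum_congr rfl fun j _ => Finset.sum_congr rfl fun i _ => by ring
    have h2 : star x ⬝ᵥ ((lam • diagonal fun j => pd B j (t • x) / (t • x) j) *ᵥ x) =
        lam * ((∑ j, pd B j (t • x) * x j) / t) := by
      rw [smul_mulVec, dotProduct_smul, smul_eq_mul, Finset.sum_div]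
      congr 1
      refine Finset.sum_congr rfl fun j _ => ?_
      have hxj := (hx j).ne'
      simp only [mulVec_diagonal, star_trivial, Pi.smul_apply, smul_eq_mul]
      field_simp
    rw [sub_mulVec, dotProduct_sub, h1, h2] at h
    exact sub_nonneg.1 h
  have hd : ∀ t : ℝ, 0 < t → HasDerivAt
      (fun s : ℝ => (1 + lam) * B (s • x) - s * ∑ j, pd B j (s • x) * x j)
      ((1 + lam) * (∑ j, pd B j (t • x) * x j) - (1 * (∑ j, pd B j (t • x) * x j) +
        t * ∑ j, (∑ i, pd (pd B j) i (t • x) * x i) * x j)) t := fun t ht =>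
    ((hg t ht).const_mul (1 + lam)).sub ((hasDerivAt_id' t).mul (hg' t ht))
  have hmono : MonotoneOn
      (fun s : ℝ => (1 + lam) * B (s • x) - s * ∑ j, pd B j (s • x) * x j) (Ioi 0) := by
    refine monotoneOn_of_deriv_nonneg (convex_Ioi 0)
      (fun t ht => (hd t ht).continuousAt.continuousWithinAt) ?_ ?_ <;>
      rw [interior_Ioi]
    · exact fun t ht => (hd t ht).differentiableAt.differentiableWithinAt
    · intro t ht
      have ht' : 0 < t := ht
      rw [(hd t ht).deriv]
      have h := mul_le_mul_of_nonneg_left (hH t ht) ht'.le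
      rw [mul_left_comm, mul_div_cancel₀ _ ht'.ne'] at h
      linarith
  simpa using nonneg_of_monotoneOn_sub_mul_deriv (by linarith : 0 ≤ 1 + lam) hg
    (fun t ht => hB_pos _ (hpos t ht)) hmono
end
end
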